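/- arXiv:math/0101147 — 4 statements merged into one kernel-verified Lean document; each statement's English description precedes it below -/
import Mathlib

section
/- For every integer d ≥ 1, the number N of (2d−2)-tuples (γ_1, …, γ_{2d−2}) of transpositions in S_d such that γ_1 ⋯ γ_{2d−2} is the identity and γ_1, …, γ_{2d−2} generate the full symmetric group S_d satisfies d³ · N = (2d−2)! · d^d; equivalently, for d ≥ 3, N = (2d−2)! · d^{d−3}. (Hurwitz's formula for the genus 0 Hurwitz numbers H_{0,d} = N/d! = (2d−2)! d^{d−3}/d!.) -/
section HurwitzCount

open Finset

theorem prod_erase_range_sub (M i : ℕ) (hi : i < M) :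
    ∏ j ∈ (range M).erase i, ((j : ℝ) - i) =
      (-1) ^ i * i.factorial * (M - 1 - i).factorial := by
  obtain ⟨m, rfl⟩ : ∃ m, M = i + 1 + m := ⟨M - (i + 1), by omega⟩
  have hsplit : (range (i + 1 + m)).erase i = range i ∪ Ico (i + 1) (i + 1 + m) := by
    ext j; simp only [mem_erase, mem_range, mem_union, mem_Ico]; omega
  rw [hsplit, prod_union (by
    rw [disjoint_left]; intro j; simp only [mem_range, mem_Ico]; omega)]
  congr 1
  · rw [← prod_range_reflect, ← prod_range_add_one_eq_factorial]
    push_cast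
    rw [← card_range i, ← prod_const, card_range, ← prod_mul_distrib]
    refine prod_congr rfl fun j hj => ?_
    have : j + 1 ≤ i := by simpa using hj
    rw [show i - 1 - j = i - (j + 1) by omega, Nat.cast_sub this]
    push_cast; ring
  · rw [prod_Ico_eq_prod_range, show i + 1 + m - (i + 1) = m by omega,
      show i + 1 + m - 1 - i = m by omega, ← prod_range_add_one_eq_factorial]
    push_cast
    exact prod_congr rfl fun j _ => by ring

theorem pow_div_prod_eq_sum (m : ℕ) {b : ℝ} (hb : 0 ≤ b) :
    b ^ m / ∏ i ∈ range (m + 1), (b + (i + 1)) =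
      ∑ i ∈ range (m + 1),
        (-((i : ℝ) + 1)) ^ m * ((-1) ^ i / (i.factorial * (m - i).factorial)) / (b + (i + 1)) := by
  set v : ℕ → ℝ := fun i => -((i : ℝ) + 1) with hv
  have hinj : Set.InjOn v (range (m + 1) : Finset ℕ) := by
    intro i _ j _ h
    have : (i : ℝ) = j := by simp only [hv] at h; linarith
    exact_mod_cast this
  have hne : ∀ i ∈ range (m + 1), b ≠ v i := by
    intro i _ h
    have : (0 : ℝ) ≤ i := Nat.cast_nonneg i
    simp only [hv] at h; linarith
  have h1 := Lagrange.eq_interpolate_of_eval_eq (s := range (m + 1)) (fun i => (v i) ^ m)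
    (f := Polynomial.X ^ m) hinj (by simp; exact_mod_cast Nat.lt_succ_self m) (by simp)
  have h2 := Lagrange.eval_interpolate_not_at_node (s := range (m + 1)) (v := v)
    (fun i => (v i) ^ m) hne
  rw [← h1, Lagrange.eval_nodal] at h2
  simp only [Polynomial.eval_pow, Polynomial.eval_X] at h2
  have hprod : ∏ i ∈ range (m + 1), (b - v i) = ∏ i ∈ range (m + 1), (b + (i + 1)) :=
    prod_congr rfl fun i _ => by simp only [hv]; ring
  have hpos : 0 < ∏ i ∈ range (m + 1), (b + ((i : ℝ) + 1)) :=
    prod_pos fun i _ => by positivity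
  rw [h2, hprod, mul_div_cancel_left₀ _ hpos.ne']
  refine sum_congr rfl fun i hi => ?_
  have hw : Lagrange.nodalWeight (range (m + 1)) v i =
      (-1) ^ i / (i.factorial * (m - i).factorial) := by
    rw [Lagrange.nodalWeight, prod_inv_distrib]
    have h3 : ∏ j ∈ (range (m + 1)).erase i, (v i - v j) =
        ∏ j ∈ (range (m + 1)).erase i, ((j : ℝ) - i) :=
      prod_congr rfl fun j _ => by simp only [hv]; ring
    rw [h3, prod_erase_range_sub _ _ (mem_range.mp hi)]
    have hs : ((-1 : ℝ) ^ i)⁻¹ = (-1) ^ i := by rw [← inv_pow]; norm_num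
    rw [mul_assoc, mul_inv, hs, Nat.add_sub_cancel, div_eq_mul_inv]
  rw [hw]
  simp only [hv, sub_neg_eq_add]
  ring

/-- The number `k ^ k / k!`. -/
noncomputable def selfPow (k : ℕ) : ℝ := (k : ℝ) ^ k / k.factorial

theorem selfPow_succ (k : ℕ) : selfPow (k + 1) = ((k : ℝ) + 1) ^ k / k.factorial := by
  rw [selfPow, Nat.factorial_succ]
  have := Nat.factorial_ne_zero k
  push_cast
  field_simp
  ring

theorem selfPow_pos {k : ℕ} (hk : 1 ≤ k) : 0 < selfPow k := by
  unfold selfPow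
  have : (0 : ℝ) < k := by exact_mod_cast hk
  positivity

/-- The convolution `∑ selfPow β * selfPow (a - β) / (β + b)` over `1 ≤ β < a`. -/
noncomputable def abelConv (a : ℕ) (b : ℝ) : ℝ :=
  ∑ β ∈ Ico 1 a, selfPow β * selfPow (a - β) / (β + b)

theorem add_pow_div_factorial (x y : ℝ) (n : ℕ) :
    ∑ k ∈ range (n + 1), x ^ k * y ^ (n - k) / (k.factorial * (n - k).factorial) =
      (x + y) ^ n / n.factorial := by
  rw [add_pow, sum_div]
  refine sum_congr rfl fun k hk => ?_
  rw [Nat.cast_choose ℝ (by simpa [Nat.lt_succ_iff] using hk)]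
  have := Nat.factorial_ne_zero n
  field_simp

theorem abelConv_eq (n : ℕ) {b : ℝ} (hb : 0 ≤ b) :
    abelConv (n + 1) b = ∑ k ∈ range n,
      ((n : ℝ) + 1) ^ k * b ^ (n - 1 - k) / (k.factorial * ∏ i ∈ range (n - k), (b + (i + 1))) := by
  have h1 : ∀ k ∈ range n, ((n : ℝ) + 1) ^ k * b ^ (n - 1 - k) /
        (k.factorial * ∏ i ∈ range (n - k), (b + (i + 1))) =
      ∑ i ∈ range (n - k), ((n : ℝ) + 1) ^ k / k.factorial * ((-((i : ℝ) + 1)) ^ (n - 1 - k) *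
        ((-1) ^ i / (i.factorial * (n - 1 - k - i).factorial)) / (b + (i + 1))) := by
    intro k hk
    have hk' : n - k = n - 1 - k + 1 := by have := mem_range.mp hk; omega
    rw [hk', ← mul_sum, ← pow_div_prod_eq_sum _ hb, mul_div_mul_comm]
  rw [sum_congr rfl h1, sum_comm' (t' := range n) (s' := fun i => range (n - i))
    (by intro x y; simp only [mem_range]; omega), abelConv, sum_Ico_eq_sum_range]
  refine sum_congr (by simp) fun i hi => ?_
  have hi' : i < n := by simpa using hi
  obtain ⟨N, rfl⟩ : ∃ N, n = i + 1 + N := ⟨n - (i + 1), by omega⟩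
  rw [show i + 1 + N + 1 - (1 + i) = N + 1 by omega, add_comm 1 i,
    show i + 1 + N - i = N + 1 by omega, selfPow_succ, selfPow_succ]
  have key := add_pow_div_factorial ((i : ℝ) + 1 + N + 1) (-((i : ℝ) + 1)) N
  rw [show (i : ℝ) + 1 + N + 1 + -((i : ℝ) + 1) = N + 1 by ring] at key
  rw [← key, mul_sum, sum_div]
  refine sum_congr (by congr 1) fun x hx => ?_
  have hx' : x ≤ N := by simpa [Nat.lt_succ_iff] using hx
  rw [show i + 1 + N - 1 - x = i + (N - x) by omega, show i + (N - x) - i = N - x by omega,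
    pow_add, neg_pow ((i : ℝ) + 1) i]
  have hs : ((-1 : ℝ) ^ i) * (-1) ^ i = 1 := by rw [← mul_pow]; simp
  push_cast
  have e1 : (i : ℝ) + 1 + b = b + (i + 1) := by ring
  rw [e1]
  linear_combination (-((i : ℝ) + 1) ^ i * (i + 1 + N + 1) ^ x * (-((i : ℝ) + 1)) ^ (N - x) *
    (x.factorial : ℝ)⁻¹ * (i.factorial : ℝ)⁻¹ * ((N - x).factorial : ℝ)⁻¹ *
    (b + (i + 1))⁻¹) * hs

theorem abelConv_zero {a : ℕ} (ha : 1 ≤ a) : abelConv a 0 = selfPow a * (1 - 1 / a) := by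
  obtain ⟨n, rfl⟩ : ∃ n, a = n + 1 := ⟨a - 1, by omega⟩
  rw [abelConv_eq n le_rfl]
  rcases n with _ | n
  · simp
  rw [sum_range_succ, sum_eq_zero, zero_add]
  · rw [selfPow_succ, Nat.factorial_succ]
    have := Nat.factorial_ne_zero n
    simp
    field_simp
    ring
  · intro k hk
    have : n + 1 - 1 - k ≠ 0 := by have := mem_range.mp hk; omega
    rw [zero_pow this]; simp

theorem factorial_mul_prod_add (b M : ℕ) :
    (b.factorial : ℝ) * ∏ i ∈ range M, ((b : ℝ) + (i + 1)) = (b + M).factorial := by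
  induction M with
  | zero => simp
  | succ M ih =>
    rw [prod_range_succ, ← mul_assoc, ih, ← add_assoc b, Nat.factorial_succ]
    push_cast; ring

theorem mul_selfPow_mul_abelConv (n m : ℕ) :
    ((m : ℝ) + 1) * selfPow (m + 1) * abelConv (n + 1) ((m : ℝ) + 1) = ∑ k ∈ range n,
      ((n : ℝ) + 1) ^ k * ((m : ℝ) + 1) ^ (n + m + 1 - k) /
        (k.factorial * (n + m + 1 - k).factorial) := by
  rw [abelConv_eq n (by positivity), mul_sum]
  refine sum_congr rfl fun k hk => ?_
  obtain ⟨l, rfl⟩ : ∃ l, n = k + 1 + l := ⟨n - (k + 1), by have := mem_range.mp hk; omega⟩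
  have h := factorial_mul_prod_add (m + 1) (l + 1)
  rw [show k + 1 + l + m + 1 - k = m + 1 + (l + 1) by omega, ← h, selfPow,
    show k + 1 + l - 1 - k = l by omega, show k + 1 + l - k = l + 1 by omega]
  have h1 := Nat.factorial_ne_zero (m + 1)
  have h2 := Nat.factorial_ne_zero k
  have h3 : 0 < ∏ i ∈ range (l + 1), ((m : ℝ) + 1 + (i + 1)) := prod_pos fun i _ => by positivity
  push_cast
  field_simp
  ring

theorem abelConv_symm {a b : ℕ} (ha : 1 ≤ a) (hb : 1 ≤ b) :
    b * selfPow b * abelConv a b + a * selfPow a * abelConv b a = selfPow (a + b) - 2 * selfPow a * selfPow b := by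
  obtain ⟨n, rfl⟩ : ∃ n, a = n + 1 := ⟨a - 1, by omega⟩
  obtain ⟨m, rfl⟩ : ∃ n, b = n + 1 := ⟨b - 1, by omega⟩
  push_cast
  rw [mul_selfPow_mul_abelConv, mul_selfPow_mul_abelConv]
  have key := add_pow_div_factorial ((n : ℝ) + 1) (m + 1) (n + m + 1)
  have hv : selfPow (n + 1 + (m + 1)) =
      ((n : ℝ) + 1 + (m + 1)) ^ (n + m + 1) / (n + m + 1).factorial := by
    rw [show n + 1 + (m + 1) = n + m + 1 + 1 by ring, selfPow_succ]
    push_cast; ring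
  rw [hv, ← key, show n + m + 1 + 1 = n + 1 + 1 + m by ring, sum_range_add, sum_range_succ,
    sum_range_succ]
  have hrefl : ∑ k ∈ range m, ((m : ℝ) + 1) ^ k * ((n : ℝ) + 1) ^ (m + n + 1 - k) /
        (k.factorial * (m + n + 1 - k).factorial) =
      ∑ k ∈ range m, ((n : ℝ) + 1) ^ (n + 1 + 1 + k) * ((m : ℝ) + 1) ^ (n + m + 1 - (n + 1 + 1 + k)) /
        ((n + 1 + 1 + k).factorial * (n + m + 1 - (n + 1 + 1 + k)).factorial) := by
    rw [← sum_range_reflect]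
    refine sum_congr rfl fun k hk => ?_
    have := mem_range.mp hk
    rw [show m + n + 1 - (m - 1 - k) = n + 1 + 1 + k by omega,
      show n + m + 1 - (n + 1 + 1 + k) = m - 1 - k by omega]
    ring
  rw [hrefl, show n + m + 1 - n = m + 1 by omega, show n + m + 1 - (n + 1) = m by omega,
    selfPow_succ, selfPow_succ, Nat.factorial_succ, Nat.factorial_succ]
  have h1 := Nat.factorial_ne_zero n
  have h2 := Nat.factorial_ne_zero m
  push_cast
  field_simp
  ring

section SubsetConvolution

variable {ι : Type*} [DecidableEq ι]

/-- Abel's polynomial `x * (x + ∑ i ∈ J, α i) ^ (#J - 1)` attached to a weighted finite set. -/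
noncomputable def abelPoly (α : ι → ℝ) (x : ℝ) (J : Finset ι) : ℝ :=
  if J = ∅ then 1 else x * (x + ∑ i ∈ J, α i) ^ (#J - 1)

theorem hasDerivAt_abelPoly (α : ι → ℝ) (J : Finset ι) (x : ℝ) :
    HasDerivAt (fun x => abelPoly α x J) (∑ k ∈ J, abelPoly α (x + α k) (J.erase k)) x := by
  rcases J.eq_empty_or_nonempty with rfl | hJ
  · simpa [abelPoly] using hasDerivAt_const x (1 : ℝ)
  obtain ⟨N, hN⟩ : ∃ N, #J = N + 1 := ⟨#J - 1, by have := hJ.card_pos; omega⟩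
  have hfun : (fun x => abelPoly α x J) = fun x => x * (x + ∑ i ∈ J, α i) ^ N := by
    funext x; simp [abelPoly, hJ.ne_empty, hN]
  rw [hfun]
  have hd := (hasDerivAt_id x).mul (((hasDerivAt_id x).add_const (∑ i ∈ J, α i)).pow N)
  refine hd.congr_deriv ?_
  rcases N with _ | N
  · obtain ⟨k, rfl⟩ := card_eq_one.mp hN
    simp [abelPoly]
  · have hterm : ∀ k ∈ J, abelPoly α (x + α k) (J.erase k) =
        (x + α k) * (x + ∑ i ∈ J, α i) ^ N := by
      intro k hk
      have hc : #(J.erase k) = N + 1 := by rw [card_erase_of_mem hk, hN]; rfl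
      have hne : J.erase k ≠ ∅ := by
        intro h; rw [h] at hc; simp at hc
      rw [abelPoly, if_neg hne, hc, ← add_sum_erase J α hk]
      simp [add_assoc]
    rw [sum_congr rfl hterm, ← sum_mul, sum_add_distrib, sum_const, hN]
    simp
    ring

theorem sum_powerset_sum_mem {M : Type*} [AddCommMonoid M] (J : Finset ι)
    (f : ι → Finset ι → Finset ι → M) :
    ∑ S ∈ J.powerset, ∑ k ∈ S, f k (S.erase k) (J \ S) =
      ∑ k ∈ J, ∑ S ∈ (J.erase k).powerset, f k S (J.erase k \ S) := by
  rw [sum_comm' (t' := J) (s' := fun k => J.powerset.filter (k ∈ ·))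
    (by intro S k; simp only [mem_powerset, mem_filter]; exact ⟨fun h => ⟨h, h.1 h.2⟩, fun h => h.1⟩)]
  refine sum_congr rfl fun k hk => ?_
  refine sum_bij' (fun S _ => S.erase k) (fun S _ => insert k S) ?_ ?_ ?_ ?_ ?_
  · intro S hS
    simp only [mem_filter, mem_powerset] at hS ⊢
    exact erase_subset_erase _ hS.1
  · intro S hS
    simp only [mem_filter, mem_powerset] at hS ⊢
    exact ⟨insert_subset hk (hS.trans (erase_subset _ _)), mem_insert_self _ _⟩
  · intro S hS
    exact insert_erase (mem_filter.mp hS).2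
  · intro S hS
    exact erase_insert fun h => by simpa using mem_powerset.mp hS h
  · intro S hS
    congr 1
    ext x
    have := (mem_filter.mp hS).2
    simp only [mem_sdiff, mem_erase]
    grind

theorem sum_powerset_sum_sdiff {M : Type*} [AddCommMonoid M] (J : Finset ι)
    (f : ι → Finset ι → Finset ι → M) :
    ∑ S ∈ J.powerset, ∑ k ∈ J \ S, f k S ((J \ S).erase k) =
      ∑ k ∈ J, ∑ S ∈ (J.erase k).powerset, f k S (J.erase k \ S) := by
  have hinv : ∀ (K : Finset ι) (g : Finset ι → Finset ι → M),
      ∑ S ∈ K.powerset, g S (K \ S) = ∑ S ∈ K.powerset, g (K \ S) S := by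
    intro K g
    refine sum_bij' (fun S _ => K \ S) (fun S _ => K \ S) ?_ ?_ ?_ ?_ ?_ <;>
      intro S hS <;> simp_all
  rw [hinv J (fun S T => ∑ k ∈ T, f k S (T.erase k)),
    sum_powerset_sum_mem J (fun k S T => f k T S)]
  exact sum_congr rfl fun k _ => (hinv (J.erase k) (f k)).symm

/-- Hurwitz's multivariate extension of Abel's binomial theorem. -/
theorem sum_powerset_abelPoly_mul (α : ι → ℝ) (J : Finset ι) (x y : ℝ) :
    ∑ S ∈ J.powerset, abelPoly α x S * abelPoly α y (J \ S) = abelPoly α (x + y) J := by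
  induction hn : #J generalizing J x y with
  | zero => 
    obtain rfl := card_eq_zero.mp hn
    simp [abelPoly]
  | succ n ih =>
    set c := x + y with hc
    set f : ℝ → ℝ := fun t => ∑ S ∈ J.powerset, abelPoly α t S * abelPoly α (c - t) (J \ S) with hf
    have hder : ∀ t, HasDerivAt f 0 t := by
      intro t
      have h1 : HasDerivAt f (∑ S ∈ J.powerset,
          ((∑ k ∈ S, abelPoly α (t + α k) (S.erase k)) * abelPoly α (c - t) (J \ S) +
          abelPoly α t S * -(∑ k ∈ J \ S, abelPoly α (c - t + α k) ((J \ S).erase k)))) t := by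
        refine HasDerivAt.fun_sum fun S _ => ?_
        refine (hasDerivAt_abelPoly α S t).mul ?_
        exact (hasDerivAt_abelPoly α (J \ S) (c - t)).comp_const_sub c t
      refine h1.congr_deriv ?_
      simp only [mul_neg, sum_add_distrib, sum_neg_distrib, sum_mul, mul_sum]
      rw [sum_powerset_sum_mem J (fun k S T => abelPoly α (t + α k) S * abelPoly α (c - t) T),
        sum_powerset_sum_sdiff J (fun k S T => abelPoly α t S * abelPoly α (c - t + α k) T),
        ← sub_eq_add_neg, sub_eq_zero]
      refine sum_congr rfl fun k hk => ?_
      have hcard : #(J.erase k) = n := by rw [card_erase_of_mem hk, hn]; rfl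
      rw [ih _ _ _ hcard, ih _ _ _ hcard]
      congr 1; ring
    have hconst := is_const_of_deriv_eq_zero (fun t => (hder t).differentiableAt)
      (fun t => (hder t).deriv) x 0
    have hx : f x = ∑ S ∈ J.powerset, abelPoly α x S * abelPoly α y (J \ S) := by
      simp [hf, hc]
    rw [← hx, hconst]
    simp only [hf, sub_zero]
    rw [sum_eq_single ∅]
    · simp [abelPoly]
    · intro S _ hS
      simp [abelPoly, hS]
    · simp

end SubsetConvolution

section CutSum

variable {ι : Type*} [DecidableEq ι]

theorem abelPoly_eq_zpow (α : ι → ℝ) {x : ℝ} (hx : 0 < x) (J : Finset ι) :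
    abelPoly α x J = x * (x + ∑ i ∈ J, α i) ^ ((#J : ℤ) - 1) := by
  rcases J.eq_empty_or_nonempty with rfl | hJ
  · simp [abelPoly, hx.ne']
  obtain ⟨N, hN⟩ : ∃ N, #J = N + 1 := ⟨#J - 1, by have := hJ.card_pos; omega⟩
  simp [abelPoly, hJ.ne_empty, hN]

theorem zpow_card_sub_two_eq (α : ι → ℝ) (S : Finset ι) (hα : ∀ i ∈ S, 0 < α i) {x : ℝ}
    (hx : 0 < x) :
    (x + ∑ i ∈ S, α i) ^ ((#S : ℤ) - 2) = 1 / x ^ 2 * abelPoly α x S -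
      ∑ k ∈ S, α k / (x * (x + α k)) * abelPoly α (x + α k) (S.erase k) := by
  have hn : 0 < x + ∑ i ∈ S, α i := add_pos_of_pos_of_nonneg hx (sum_nonneg fun i hi => (hα i hi).le)
  have hterm : ∀ k ∈ S, α k / (x * (x + α k)) * abelPoly α (x + α k) (S.erase k) =
      α k * ((x + ∑ i ∈ S, α i) ^ ((#S : ℤ) - 2) / x) := by
    intro k hk
    have h1 := hα k hk
    have hc : ((#(S.erase k) : ℕ) : ℤ) - 1 = (#S : ℤ) - 2 := by
      have := card_erase_add_one hk
      omega
    rw [abelPoly_eq_zpow α (by positivity), hc, add_assoc, add_sum_erase S α hk]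
    field_simp
  rw [sum_congr rfl hterm, ← sum_mul, abelPoly_eq_zpow α hx,
    show (#S : ℤ) - 1 = ((#S : ℤ) - 2) + 1 by ring, zpow_add_one₀ hn.ne']
  field_simp
  ring

theorem sum_powerset_zpow_mul_abelPoly (α : ι → ℝ) (J : Finset ι) (hα : ∀ i ∈ J, 0 < α i)
    {x : ℝ} (hx : 0 < x) (y : ℝ) :
    ∑ S ∈ J.powerset, (x + ∑ i ∈ S, α i) ^ ((#S : ℤ) - 2) * abelPoly α y (J \ S) =
      1 / x ^ 2 * abelPoly α (x + y) J -
        ∑ k ∈ J, α k / (x * (x + α k)) * abelPoly α (x + α k + y) (J.erase k) := by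
  have h1 : ∀ S ∈ J.powerset,
      (x + ∑ i ∈ S, α i) ^ ((#S : ℤ) - 2) * abelPoly α y (J \ S) =
      1 / x ^ 2 * (abelPoly α x S * abelPoly α y (J \ S)) -
        ∑ k ∈ S, α k / (x * (x + α k)) *
          (abelPoly α (x + α k) (S.erase k) * abelPoly α y (J \ S)) := by
    intro S hS
    rw [zpow_card_sub_two_eq α S (fun i hi => hα i (mem_powerset.mp hS hi)) hx, sub_mul, sum_mul]
    congr 1
    · ring
    · exact sum_congr rfl fun k _ => by ring
  rw [sum_congr rfl h1, sum_sub_distrib, ← mul_sum, sum_powerset_abelPoly_mul,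
    sum_powerset_sum_mem J fun k S T => α k / (x * (x + α k)) *
      (abelPoly α (x + α k) S * abelPoly α y T)]
  congr 1
  refine sum_congr rfl fun k _ => ?_
  rw [← mul_sum, sum_powerset_abelPoly_mul]

theorem sum_powerset_zpow_mul_zpow (α : ι → ℝ) (J : Finset ι) (hα : ∀ i ∈ J, 0 < α i)
    {x y : ℝ} (hx : 0 < x) (hy : 0 < y) :
    ∑ S ∈ J.powerset, (x + ∑ i ∈ S, α i) ^ ((#S : ℤ) - 2) *
        (y + ∑ i ∈ J \ S, α i) ^ ((#(J \ S) : ℤ) - 2) =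
      1 / y ^ 2 * (1 / x ^ 2 * abelPoly α (x + y) J -
        ∑ k ∈ J, α k / (x * (x + α k)) * abelPoly α (x + α k + y) (J.erase k)) -
      ∑ l ∈ J, α l / (y * (y + α l)) * (1 / x ^ 2 * abelPoly α (x + (y + α l)) (J.erase l) -
        ∑ k ∈ J.erase l, α k / (x * (x + α k)) *
          abelPoly α (x + α k + (y + α l)) ((J.erase l).erase k)) := by
  have h1 : ∀ S ∈ J.powerset, (x + ∑ i ∈ S, α i) ^ ((#S : ℤ) - 2) *
        (y + ∑ i ∈ J \ S, α i) ^ ((#(J \ S) : ℤ) - 2) =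
      1 / y ^ 2 * ((x + ∑ i ∈ S, α i) ^ ((#S : ℤ) - 2) * abelPoly α y (J \ S)) -
        ∑ l ∈ J \ S, α l / (y * (y + α l)) *
          ((x + ∑ i ∈ S, α i) ^ ((#S : ℤ) - 2) * abelPoly α (y + α l) ((J \ S).erase l)) := by
    intro S _
    rw [zpow_card_sub_two_eq α (J \ S) (fun i hi => hα i (mem_sdiff.mp hi).1) hy, mul_sub,
      mul_sum]
    congr 1
    · ring
    · exact sum_congr rfl fun k _ => by ring
  rw [sum_congr rfl h1, sum_sub_distrib, ← mul_sum, sum_powerset_zpow_mul_abelPoly α J hα hx,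
    sum_powerset_sum_sdiff J fun l S T => α l / (y * (y + α l)) *
      ((x + ∑ i ∈ S, α i) ^ ((#S : ℤ) - 2) * abelPoly α (y + α l) T)]
  congr 1
  refine sum_congr rfl fun l _ => ?_
  rw [← mul_sum, sum_powerset_zpow_mul_abelPoly α _ (fun i hi => hα i (mem_of_mem_erase hi)) hx]

/-- With `x + y = a`, partial fractions reduce the double sum over subsets to simple poles. -/
theorem mul_mul_sum_powerset_zpow_mul_zpow (α : ι → ℝ) (J : Finset ι) (hα : ∀ i ∈ J, 0 < α i)
    {x y n : ℝ} (hx : 0 < x) (hy : 0 < y) (hn : x + y + ∑ i ∈ J, α i = n) :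
    x * y * ∑ S ∈ J.powerset, (x + ∑ i ∈ S, α i) ^ ((#S : ℤ) - 2) *
        (y + ∑ i ∈ J \ S, α i) ^ ((#(J \ S) : ℤ) - 2) =
      (x + y) * n ^ ((#J : ℤ) - 2) * (1 / (x + 0) + 1 / (y + 0)) -
        n ^ ((#J : ℤ) - 3) * ∑ k ∈ J, α k * (x + y + α k) * (1 / (x + α k) + 1 / (y + α k)) := by
  have hn0 : 0 < n := by
    rw [← hn]; exact add_pos_of_pos_of_nonneg (by positivity) (sum_nonneg fun i hi => (hα i hi).le)
  have hJ1 : abelPoly α (x + y) J = (x + y) * n ^ ((#J : ℤ) - 3) * n ^ 2 := by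
    rw [abelPoly_eq_zpow α (by positivity), hn, mul_assoc, ← zpow_natCast, ← zpow_add₀ hn0.ne']
    congr 2; push_cast; ring
  have hJ2 : ∀ k ∈ J, ∀ z, z = x + y + α k →
      abelPoly α z (J.erase k) = (x + y + α k) * n ^ ((#J : ℤ) - 3) * n := by
    rintro k hk _ rfl
    have h1 := hα k hk
    rw [abelPoly_eq_zpow α (by positivity), add_assoc (x + y), add_sum_erase J α hk, hn, mul_assoc,
      ← zpow_add_one₀ hn0.ne']
    congr 2
    have := card_erase_add_one hk
    omega
  have hJ3 : ∀ l ∈ J, ∀ k ∈ J.erase l, abelPoly α (x + α k + (y + α l)) ((J.erase l).erase k) =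
      (x + α k + (y + α l)) * n ^ ((#J : ℤ) - 3) := by
    intro l hl k hk
    have h1 := hα l hl
    have h2 := hα k (mem_of_mem_erase hk)
    rw [abelPoly_eq_zpow α (by positivity),
      show x + α k + (y + α l) + ∑ i ∈ (J.erase l).erase k, α i = n by
        rw [← hn, ← add_sum_erase J α hl, ← add_sum_erase _ α hk]; ring]
    congr 2
    have := card_erase_add_one hl
    have := card_erase_add_one hk
    omega
  rw [sum_powerset_zpow_mul_zpow α J hα hx hy, hJ1]
  set N := n ^ ((#J : ℤ) - 3) with hN
  have hN2 : n ^ ((#J : ℤ) - 2) = N * n := by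
    rw [hN, ← zpow_add_one₀ hn0.ne']; congr 1; ring
  have e1 : ∑ k ∈ J, α k / (x * (x + α k)) * abelPoly α (x + α k + y) (J.erase k) =
      N * n / x * ∑ k ∈ J, α k * (x + y + α k) / (x + α k) := by
    rw [mul_sum]
    refine sum_congr rfl fun k hk => ?_
    rw [hJ2 k hk _ (by ring)]
    have := hα k hk
    field_simp
  have e2 : ∀ l ∈ J, ∑ k ∈ J.erase l, α k / (x * (x + α k)) *
          abelPoly α (x + α k + (y + α l)) ((J.erase l).erase k) =
      N / x * ∑ k ∈ J.erase l, α k * ((x + α k) + (y + α l)) / (x + α k) := by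
    intro l hl
    rw [mul_sum]
    refine sum_congr rfl fun k hk => ?_
    rw [hJ3 l hl k hk]
    have := hα k (mem_of_mem_erase hk)
    field_simp
  have e3 : ∑ l ∈ J, α l / (y * (y + α l)) * (1 / x ^ 2 * abelPoly α (x + (y + α l)) (J.erase l) -
        ∑ k ∈ J.erase l, α k / (x * (x + α k)) *
          abelPoly α (x + α k + (y + α l)) ((J.erase l).erase k)) =
      N * n / (y * x ^ 2) * ∑ k ∈ J, α k * (x + y + α k) / (y + α k) -
      N / (x * y) * ∑ l ∈ J, ∑ k ∈ J.erase l,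
        (α l * α k / (x + α k) + α l * α k / (y + α l)) := by
    rw [mul_sum, mul_sum, ← sum_sub_distrib]
    refine sum_congr rfl fun l hl => ?_
    rw [e2 l hl, hJ2 l hl _ (by ring), mul_sub]
    have hl0 := hα l hl
    congr 1
    · field_simp
    · rw [mul_sum, mul_sum, mul_sum]
      refine sum_congr rfl fun k hk => ?_
      have := hα k (mem_of_mem_erase hk)
      field_simp
      ring
  have e4 : ∀ z : ℝ, 0 < z → ∑ l ∈ J, ∑ k ∈ J.erase l, α l * α k / (z + α l) =
      ∑ l ∈ J, α l * (n - (x + y) - α l) / (z + α l) := by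
    intro z hz
    refine sum_congr rfl fun l hl => ?_
    rw [← sum_div, ← mul_sum]
    congr 2
    rw [← hn, ← add_sum_erase J α hl]; ring
  have e5 : ∑ l ∈ J, ∑ k ∈ J.erase l, α l * α k / (x + α k) =
      ∑ l ∈ J, ∑ k ∈ J.erase l, α l * α k / (x + α l) := by
    rw [sum_comm' (t' := J) (s' := fun k => J.erase k) (by intro a b; simp only [mem_erase]; tauto)]
    exact sum_congr rfl fun l _ => sum_congr rfl fun k _ => by rw [mul_comm (α k)]
  rw [e1, e3]
  simp only [sum_add_distrib]
  rw [e5, e4 x hx, e4 y hy, hN2]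
  have s1 : ∀ z : ℝ, 0 < z → ∑ l ∈ J, α l * (n - (x + y) - α l) / (z + α l) =
      n * ∑ l ∈ J, α l / (z + α l) - ∑ l ∈ J, α l * (x + y + α l) / (z + α l) := by
    intro z hz
    rw [mul_sum, ← sum_sub_distrib]
    exact sum_congr rfl fun l _ => by ring
  have s2 : ∀ z z' : ℝ, 0 < z → z + z' = x + y → ∑ l ∈ J, α l * (x + y + α l) / (z + α l) =
      (n - (x + y)) + z' * ∑ l ∈ J, α l / (z + α l) := by
    intro z z' hz hzz
    rw [mul_sum, ← hn, add_sub_cancel_left, ← sum_add_distrib]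
    refine sum_congr rfl fun l hl => ?_
    have := hα l hl
    rw [← hzz]
    field_simp
    ring
  have s3 : ∑ k ∈ J, α k * (x + y + α k) * (1 / (x + α k) + 1 / (y + α k)) =
      ∑ l ∈ J, α l * (x + y + α l) / (x + α l) + ∑ l ∈ J, α l * (x + y + α l) / (y + α l) := by
    rw [← sum_add_distrib]
    exact sum_congr rfl fun l _ => by ring
  rw [s3, s1 x hx, s1 y hy, s2 x y hx rfl, s2 y x hy (add_comm y x), add_zero, add_zero]
  field_simp
  ring

/-- The total weight of all ways to cut a part of size `a` in two and to distribute the other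
parts among the two pieces. -/
theorem sum_cut_eq (α : ι → ℕ) (J : Finset ι) (hα : ∀ i ∈ J, 1 ≤ α i) {a : ℕ} (ha : 1 ≤ a)
    {n : ℝ} (hn : a + ∑ i ∈ J, (α i : ℝ) = n) :
    ∑ j ∈ Ico 1 a, ∑ S ∈ J.powerset,
        ((j : ℝ) + ∑ i ∈ S, (α i : ℝ)) ^ ((#S : ℤ) - 2) *
        (((a - j : ℕ) : ℝ) + ∑ i ∈ J \ S, (α i : ℝ)) ^ ((#(J \ S) : ℤ) - 2) *
        (j * selfPow j * ((a - j : ℕ) * selfPow (a - j))) =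
      2 * a * selfPow a * (1 - 1 / a) * n ^ ((#J : ℤ) - 2) -
        2 * n ^ ((#J : ℤ) - 3) * ∑ k ∈ J, α k * (a + α k) * abelConv a (α k) := by
  have hrefl : ∀ b : ℝ, ∑ j ∈ Ico 1 a, selfPow j * selfPow (a - j) *
      (1 / (j + b) + 1 / ((a - j : ℕ) + b)) = 2 * abelConv a b := by
    intro b
    simp only [mul_add, sum_add_distrib, two_mul, mul_one_div]
    congr 1
    refine sum_bij' (fun j _ => a - j) (fun j _ => a - j) ?_ ?_ ?_ ?_ ?_ <;> intro j hj <;>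
      rw [mem_Ico] at *
    · omega
    · omega
    · omega
    · omega
    · rw [show a - (a - j) = j by omega, mul_comm (selfPow j)]
  have h1 : ∀ j ∈ Ico 1 a, ∑ S ∈ J.powerset,
        ((j : ℝ) + ∑ i ∈ S, (α i : ℝ)) ^ ((#S : ℤ) - 2) *
        (((a - j : ℕ) : ℝ) + ∑ i ∈ J \ S, (α i : ℝ)) ^ ((#(J \ S) : ℤ) - 2) *
        (j * selfPow j * ((a - j : ℕ) * selfPow (a - j))) =
      a * n ^ ((#J : ℤ) - 2) * (selfPow j * selfPow (a - j) *
        (1 / (j + 0) + 1 / ((a - j : ℕ) + 0))) -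
      n ^ ((#J : ℤ) - 3) * ∑ k ∈ J, α k * (a + α k) * (selfPow j * selfPow (a - j) *
        (1 / (j + (α k : ℝ)) + 1 / ((a - j : ℕ) + (α k : ℝ)))) := by
    intro j hj
    rw [mem_Ico] at hj
    have hsum : (j : ℝ) + ((a - j : ℕ) : ℝ) = a := by
      rw [← Nat.cast_add]; congr 1; omega
    have hj0 : (0 : ℝ) < j := by exact_mod_cast hj.1
    have hj1 : (0 : ℝ) < (a - j : ℕ) := by exact_mod_cast (by omega : 0 < a - j)
    have key := mul_mul_sum_powerset_zpow_mul_zpow (fun i => (α i : ℝ)) J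
      (fun i hi => by exact_mod_cast hα i hi) hj0 hj1 (by rw [hsum, hn])
    rw [hsum] at key
    rw [← sum_mul, show ∀ X : ℝ, X * (j * selfPow j * ((a - j : ℕ) * selfPow (a - j))) =
      selfPow j * selfPow (a - j) * (j * (a - j : ℕ) * X) from fun X => by ring, key, mul_sub]
    congr 1
    · ring
    · rw [mul_sum, mul_sum, mul_sum]
      exact sum_congr rfl fun k _ => by ring
  rw [sum_congr rfl h1, sum_sub_distrib, ← mul_sum, hrefl, abelConv_zero ha, ← mul_sum, sum_comm]
  simp only [← mul_sum, hrefl]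
  congr 1
  · ring
  · simp only [mul_sum]
    exact sum_congr rfl fun k _ => by ring

/-- The cut-and-join recursion for the product formula. -/
theorem cut_join_identity (α : ι → ℕ) (I : Finset ι) (hα : ∀ i ∈ I, 1 ≤ α i) (hI : I.Nonempty)
    {n : ℝ} (hn : ∑ i ∈ I, (α i : ℝ) = n) :
    ∑ i ∈ I, ∑ j ∈ I.erase i, (α i : ℝ) * α j * (n ^ ((#I : ℤ) - 4) *
        (((α i + α j : ℕ) : ℝ) * selfPow (α i + α j) *
          ∏ k ∈ (I.erase i).erase j, (α k : ℝ) * selfPow (α k))) +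
      ∑ i ∈ I, (α i : ℝ) * ∑ j ∈ Ico 1 (α i), ∑ S ∈ (I.erase i).powerset,
        ((j : ℝ) + ∑ k ∈ S, (α k : ℝ)) ^ ((#S : ℤ) - 2) *
        (((α i - j : ℕ) : ℝ) + ∑ k ∈ I.erase i \ S, (α k : ℝ)) ^ ((#(I.erase i \ S) : ℤ) - 2) *
        (j * selfPow j * ((α i - j : ℕ) * selfPow (α i - j))) *
          ∏ k ∈ I.erase i, (α k : ℝ) * selfPow (α k) =
      2 * (n + #I - 2) * n ^ ((#I : ℤ) - 3) * ∏ k ∈ I, (α k : ℝ) * selfPow (α k) := by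
  have hpos : ∀ i ∈ I, 0 < (α i : ℝ) := fun i hi => by exact_mod_cast hα i hi
  have hv : ∀ i ∈ I, 0 < selfPow (α i) := fun i hi => selfPow_pos (hα i hi)
  have hn0 : 0 < n := hn ▸ sum_pos hpos hI
  set W := ∏ k ∈ I, (α k : ℝ) * selfPow (α k) with hW
  have hjoin : ∀ i ∈ I, ∀ j ∈ I.erase i, (α i : ℝ) * α j * (n ^ ((#I : ℤ) - 4) *
        (((α i + α j : ℕ) : ℝ) * selfPow (α i + α j) *
          ∏ k ∈ (I.erase i).erase j, (α k : ℝ) * selfPow (α k))) =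
      W * n ^ ((#I : ℤ) - 4) * ((α i + α j) * (selfPow (α i + α j) /
        (selfPow (α i) * selfPow (α j)))) := by
    intro i hi j hj
    have h1 := hv i hi
    have h2 := hv j (mem_of_mem_erase hj)
    rw [hW, ← mul_prod_erase I _ hi, ← mul_prod_erase _ _ hj]
    push_cast
    field_simp
  have hcut : ∀ i ∈ I, (α i : ℝ) * ∑ j ∈ Ico 1 (α i), ∑ S ∈ (I.erase i).powerset,
        ((j : ℝ) + ∑ k ∈ S, (α k : ℝ)) ^ ((#S : ℤ) - 2) *
        (((α i - j : ℕ) : ℝ) + ∑ k ∈ I.erase i \ S, (α k : ℝ)) ^ ((#(I.erase i \ S) : ℤ) - 2) *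
        (j * selfPow j * ((α i - j : ℕ) * selfPow (α i - j))) *
          ∏ k ∈ I.erase i, (α k : ℝ) * selfPow (α k) =
      W * n ^ ((#I : ℤ) - 4) * (2 * n * (α i - 1) - 2 * ∑ k ∈ I.erase i,
        (α i + α k) * (α k * abelConv (α i) (α k) / selfPow (α i))) := by
    intro i hi
    have h1 := hv i hi
    have h2 := hpos i hi
    have hcut := sum_cut_eq α (I.erase i) (fun k hk => hα k (mem_of_mem_erase hk)) (hα i hi)
      (by rw [add_sum_erase I (fun k => (α k : ℝ)) hi, hn])
    simp only [← sum_mul] at hcut ⊢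
    rw [hcut, hW, ← mul_prod_erase I _ hi]
    have hc := card_erase_add_one hi
    rw [show ((#(I.erase i) : ℕ) : ℤ) - 3 = (#I : ℤ) - 4 by omega,
      show ((#(I.erase i) : ℕ) : ℤ) - 2 = (#I : ℤ) - 4 + 1 by omega, zpow_add_one₀ hn0.ne']
    have : ∑ k ∈ I.erase i, ((α i : ℝ) + α k) * (α k * abelConv (α i) (α k) / selfPow (α i)) =
        (∑ k ∈ I.erase i, α k * ((α i : ℝ) + α k) * abelConv (α i) (α k)) / selfPow (α i) := by
      rw [sum_div]
      exact sum_congr rfl fun k _ => by ring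
    rw [this]
    field_simp
  have hsym : ∑ i ∈ I, ∑ k ∈ I.erase i,
        ((α i : ℝ) + α k) * (2 * (α k * abelConv (α i) (α k) / selfPow (α i))) =
      ∑ i ∈ I, ∑ k ∈ I.erase i, ((α i : ℝ) + α k) * (selfPow (α i + α k) /
        (selfPow (α i) * selfPow (α k)) - 2) := by
    have hswap : ∑ i ∈ I, ∑ k ∈ I.erase i,
        ((α i : ℝ) + α k) * (α k * abelConv (α i) (α k) / selfPow (α i)) =
        ∑ i ∈ I, ∑ k ∈ I.erase i,
        ((α i : ℝ) + α k) * (α i * abelConv (α k) (α i) / selfPow (α k)) := by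
      rw [sum_comm' (t' := I) (s' := fun k => I.erase k)
        (by intro a b; simp only [mem_erase]; tauto)]
      exact sum_congr rfl fun i _ => sum_congr rfl fun k _ => by rw [add_comm (α k : ℝ)]
    have hdouble : ∑ i ∈ I, ∑ k ∈ I.erase i,
        ((α i : ℝ) + α k) * (2 * (α k * abelConv (α i) (α k) / selfPow (α i))) =
        ∑ i ∈ I, ∑ k ∈ I.erase i,
        ((α i : ℝ) + α k) * (α k * abelConv (α i) (α k) / selfPow (α i)) +
        ∑ i ∈ I, ∑ k ∈ I.erase i,
        ((α i : ℝ) + α k) * (α k * abelConv (α i) (α k) / selfPow (α i)) := by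
      simp only [← sum_add_distrib]
      exact sum_congr rfl fun i _ => sum_congr rfl fun k _ => by ring
    rw [hdouble]
    nth_rewrite 2 [hswap]
    simp only [← sum_add_distrib, ← mul_add]
    refine sum_congr rfl fun i hi => sum_congr rfl fun k hk => ?_
    have h1 := hv i hi
    have h2 := hv k (mem_of_mem_erase hk)
    have h3 := abelConv_symm (hα i hi) (hα k (mem_of_mem_erase hk))
    congr 1
    field_simp
    linarith
  have hpairs : ∑ i ∈ I, ∑ k ∈ I.erase i, ((α i : ℝ) + α k) = 2 * (#I - 1) * n := by
    have : ∀ i ∈ I, ∑ k ∈ I.erase i, ((α i : ℝ) + α k) = (#I - 2) * α i + n := by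
      intro i hi
      have hc : ((#(I.erase i) : ℕ) : ℝ) = #I - 1 := by
        rw [← card_erase_add_one hi]; push_cast; ring
      rw [sum_add_distrib, sum_const, nsmul_eq_mul, hc, ← hn, ← add_sum_erase I _ hi]
      ring
    rw [sum_congr rfl this, sum_add_distrib, ← mul_sum, hn, sum_const, nsmul_eq_mul]
    ring
  have hlin : ∑ i ∈ I, (2 * n * ((α i : ℝ) - 1)) = 2 * n * (n - #I) := by
    rw [← mul_sum, sum_sub_distrib, hn]; simp
  rw [sum_congr rfl fun i hi => sum_congr rfl (hjoin i hi), sum_congr rfl hcut]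
  simp only [← mul_sum]
  rw [← mul_add, sum_sub_distrib, hlin, ← mul_sum]
  have hsym' : 2 * ∑ i ∈ I, ∑ k ∈ I.erase i,
        ((α i : ℝ) + α k) * (α k * abelConv (α i) (α k) / selfPow (α i)) =
      ∑ i ∈ I, ∑ k ∈ I.erase i, ((α i : ℝ) + α k) * (selfPow (α i + α k) /
        (selfPow (α i) * selfPow (α k))) - 2 * (2 * (#I - 1) * n) := by
    rw [← hpairs, mul_sum, mul_sum, ← sum_sub_distrib]
    simp only [mul_sum, ← sum_sub_distrib]
    rw [← sum_congr rfl fun i _ => sum_congr rfl fun k _ => mul_left_comm _ _ _, hsym]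
    exact sum_congr rfl fun i _ => sum_congr rfl fun k _ => by ring
  rw [hsym', show (#I : ℤ) - 3 = (#I : ℤ) - 4 + 1 by ring, zpow_add_one₀ hn0.ne']
  ring

end CutSum

section Words

/-- The real-valued indicator of a proposition. -/
noncomputable def ind (P : Prop) : ℝ := open Classical in if P then 1 else 0

theorem ind_of_true {P : Prop} (h : P) : ind P = 1 := by simp [ind, h]

theorem ind_of_false {P : Prop} (h : ¬P) : ind P = 0 := by simp [ind, h]

theorem ind_and (P Q : Prop) : ind (P ∧ Q) = ind P * ind Q := by
  by_cases hP : P <;> by_cases hQ : Q <;> simp [ind, hP, hQ]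

variable {α : Type*} [Fintype α]

/-- The sum of `f` over all words of length `r`. -/
noncomputable def wordSum (r : ℕ) (f : List α → ℝ) : ℝ := ∑ v : Fin r → α, f (List.ofFn v)

theorem wordSum_zero (f : List α → ℝ) : wordSum 0 f = f [] := by
  simp [wordSum]

theorem wordSum_succ (r : ℕ) (f : List α → ℝ) :
    wordSum (r + 1) f = ∑ a, wordSum r fun l => f (a :: l) := by
  simp only [wordSum]
  rw [← Fintype.sum_prod_type' (fun a (v : Fin r → α) => f (a :: List.ofFn v))]
  exact Fintype.sum_equiv (Fin.consEquiv fun _ => α).symm _ _ fun v => by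
    
    simp [Fin.consEquiv, List.ofFn_succ]
    rfl

theorem wordSum_add (r : ℕ) (f g : List α → ℝ) :
    wordSum r (fun l => f l + g l) = wordSum r f + wordSum r g := sum_add_distrib

theorem wordSum_sum {κ : Type*} (s : Finset κ) (r : ℕ) (f : κ → List α → ℝ) :
    wordSum r (fun l => ∑ k ∈ s, f k l) = ∑ k ∈ s, wordSum r (f k) := sum_comm

theorem wordSum_eq_zero {r : ℕ} {f : List α → ℝ} (h : ∀ l, f l = 0) : wordSum r f = 0 :=
  sum_eq_zero fun _ _ => h _

/-- Words whose letters satisfy one of two disjoint predicates are shuffles of two words. -/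
theorem wordSum_shuffle (p q : α → Prop) [DecidablePred p] [DecidablePred q]
    (hpq : ∀ a, p a → ¬q a) (r : ℕ) (f g : List α → ℝ) :
    wordSum r (fun l => ind (∀ a ∈ l, p a ∨ q a) * (f (l.filter p) * g (l.filter q))) =
      ∑ ij ∈ antidiagonal r, (r.choose ij.1 : ℝ) *
        (wordSum ij.1 (fun l => ind (∀ a ∈ l, p a) * f l) *
          wordSum ij.2 (fun l => ind (∀ a ∈ l, q a) * g l)) := by
  have hcons : ∀ (p : α → Prop) (i : ℕ) (f : List α → ℝ),
      wordSum (i + 1) (fun l => ind (∀ a ∈ l, p a) * f l) =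
        ∑ a, ind (p a) * wordSum i (fun l => ind (∀ a ∈ l, p a) * f (a :: l)) := by
    intro p i f
    rw [wordSum_succ]
    refine sum_congr rfl fun a _ => ?_
    simp only [wordSum, mul_sum, List.forall_mem_cons, ind_and, mul_assoc]
  induction r generalizing f g with
  | zero => simp [wordSum_zero, ind]
  | succ r ih =>
    rw [Finset.sum_antidiagonal_choose_succ_mul (fun i j =>
      wordSum i (fun l => ind (∀ a ∈ l, p a) * f l) *
        wordSum j (fun l => ind (∀ a ∈ l, q a) * g l))]
    simp only [hcons, mul_sum, sum_mul]
    rw [sum_comm, sum_comm (s := antidiagonal r), ← sum_add_distrib]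
    refine sum_congr rfl fun a _ => ?_
    have hchoose : ∀ ij ∈ antidiagonal r, (r.choose ij.2 : ℝ) = r.choose ij.1 := fun ij hij => by
      rw [Nat.choose_symm_of_eq_add (mem_antidiagonal.mp hij).symm]
    by_cases hpa : p a
    · have hqa := hpq a hpa
      simp only [hpa, hqa, true_or, List.filter_cons, decide_true, decide_false, if_true,
        ind_of_true trivial, ind_of_false not_false, Bool.false_eq_true, if_false, one_mul,
        zero_mul, mul_zero, sum_const_zero, zero_add]
      rw [ih (fun l => f (a :: l)) g]
      exact sum_congr rfl fun ij hij => by rw [hchoose ij hij]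
    · by_cases hqa : q a
      · simp only [hpa, hqa, or_true, List.filter_cons, decide_true, decide_false, if_true,
          ind_of_true trivial, ind_of_false not_false, Bool.false_eq_true, if_false, one_mul,
          zero_mul, mul_zero, sum_const_zero, add_zero]
        exact ih f (fun l => g (a :: l))
      · simp [hpa, hqa, ind_of_false not_false]

end Words

section Splitting

variable {X : Type*} [DecidableEq X]

/-- `B` is a union of connected components of the graph with edge list `l`. -/
def IsSaturated (B : Finset X) (l : List (X × X)) : Prop := ∀ p ∈ l, p.1 ∈ B ↔ p.2 ∈ B

/-- The edge list `l` without loops defines a connected graph with vertex set `A`. -/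
def IsConnectedOn (A : Finset X) (l : List (X × X)) : Prop :=
  A.Nonempty ∧ (∀ p ∈ l, p ∈ A.offDiag) ∧
    ∀ B ⊆ A, B.Nonempty → IsSaturated B l → B = A

/-- The product of the transpositions given by the letters of a word. -/
def wordProd (l : List (X × X)) : Equiv.Perm X := (l.map fun p => Equiv.swap p.1 p.2).prod

/-- The edge list `l` is connected on `A` and its product agrees with `ρ` on `A`. -/
def IsFactorizationOn (A : Finset X) (ρ : Equiv.Perm X) (l : List (X × X)) : Prop :=
  IsConnectedOn A l ∧ ∀ x ∈ A, wordProd l x = ρ x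

theorem wordProd_cons (p : X × X) (l : List (X × X)) :
    wordProd (p :: l) = Equiv.swap p.1 p.2 * wordProd l := by
  simp [wordProd]

theorem wordProd_apply_mem {B : Finset X} {l : List (X × X)}
    (hl : ∀ p ∈ l, p.1 ∈ B ↔ p.2 ∈ B) {x : X} (hx : x ∈ B) : wordProd l x ∈ B := by
  induction l with
  | nil => simpa [wordProd]
  | cons p l ih =>
    have h1 := ih fun q hq => hl q (List.mem_cons_of_mem _ hq)
    have h2 := hl p List.mem_cons_self
    rw [wordProd_cons, Equiv.Perm.mul_apply, Equiv.swap_apply_def]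
    split_ifs with h3 h4
    · exact h2.mp (h3 ▸ h1)
    · exact h2.mpr (h4 ▸ h1)
    · exact h1

theorem wordProd_filter_apply {B : Finset X} {l : List (X × X)}
    (hl : ∀ p ∈ l, p ∈ B.offDiag ∨ (p.1 ∉ B ∧ p.2 ∉ B)) {x : X} (hx : x ∈ B) :
    wordProd (l.filter (· ∈ B.offDiag)) x = wordProd l x := by
  induction l with
  | nil => rfl
  | cons p l ih =>
    have hl' : ∀ q ∈ l, q ∈ B.offDiag ∨ (q.1 ∉ B ∧ q.2 ∉ B) :=
      fun q hq => hl q (List.mem_cons_of_mem _ hq)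
    have h1 := ih hl'
    rcases hl p List.mem_cons_self with h | h
    · rw [List.filter_cons_of_pos (by simpa using h), wordProd_cons, wordProd_cons,
        Equiv.Perm.mul_apply, Equiv.Perm.mul_apply, h1]
    · have hmem : wordProd l x ∈ B := wordProd_apply_mem (fun q hq => by
        rcases hl' q hq with h | h
        · rw [mem_offDiag] at h; tauto
        · tauto) hx
      rw [List.filter_cons_of_neg (by simp [h.1]), h1, wordProd_cons, Equiv.Perm.mul_apply,
        Equiv.swap_apply_of_ne_of_ne]
      · rintro h'; exact h.1 (h' ▸ hmem)
      · rintro h'; exact h.2 (h' ▸ hmem)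

/-- `B` and `A \ B` are the two connected components of `l`. -/
def IsSplitting (A B : Finset X) (l : List (X × X)) : Prop :=
  (∀ p ∈ l, p ∈ B.offDiag ∨ p ∈ (A \ B).offDiag) ∧
    IsConnectedOn B (l.filter (· ∈ B.offDiag)) ∧
    IsConnectedOn (A \ B) (l.filter (· ∈ (A \ B).offDiag))

theorem IsConnectedOn.cons {A : Finset X} {l : List (X × X)} (h : IsConnectedOn A l) {p : X × X}
    (hp : p ∈ A.offDiag) : IsConnectedOn A (p :: l) :=
  ⟨h.1, List.forall_mem_cons.mpr ⟨hp, h.2.1⟩, fun B hB hne hs =>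
    h.2.2 B hB hne fun q hq => hs q (List.mem_cons_of_mem _ hq)⟩

theorem IsSplitting.isSaturated {A B : Finset X} {l : List (X × X)}
    (h : IsSplitting A B l) : IsSaturated B l := by
  intro p hp
  have := h.1 p hp
  simp only [mem_offDiag, mem_sdiff] at this
  tauto

theorem IsSplitting.eq_of_isSaturated {A B C : Finset X} {l : List (X × X)}
    (h : IsSplitting A B l) (hC : IsSaturated C l) {x : X} (hxB : x ∈ B) (hxC : x ∈ C) :
    B ⊆ C := by
  have := h.2.1.2.2 (B ∩ C) inter_subset_left ⟨x, mem_inter.mpr ⟨hxB, hxC⟩⟩ (by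
    intro p hp
    have h1 := List.mem_filter.mp hp
    have h2 := h.isSaturated p h1.1
    have h3 := hC p h1.1
    simp only [mem_inter]
    tauto)
  exact inter_eq_left.mp this

theorem IsSplitting.symm {A B : Finset X} {l : List (X × X)} (hB : B ⊆ A)
    (h : IsSplitting A B l) : IsSplitting A (A \ B) l := by
  have : A \ (A \ B) = B := Finset.sdiff_sdiff_eq_self hB
  refine ⟨fun p hp => ?_, h.2.2, ?_⟩
  · rw [this]; exact (h.1 p hp).symm
  · simp only [this]; exact h.2.1

theorem IsSplitting.not_isConnectedOn {A B : Finset X} {b : X} {l : List (X × X)}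
    (h : IsSplitting A B l) (hB : B ⊆ A) (hb : b ∈ A) (hbB : b ∉ B) :
    ¬IsConnectedOn A l := fun hA =>
  hbB (hA.2.2 B hB h.2.1.1 h.isSaturated ▸ hb)

theorem IsSplitting.isConnectedOn_cons {A B : Finset X} {a b : X} {l : List (X × X)}
    (h : IsSplitting A B l) (hB : B ⊆ A) (ha : a ∈ B) (hb : b ∈ A) (hbB : b ∉ B) :
    IsConnectedOn A ((a, b) :: l) := by
  refine ⟨⟨b, hb⟩, List.forall_mem_cons.mpr ⟨?_, fun p hp => ?_⟩, ?_⟩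
  · simp only [mem_offDiag]; exact ⟨hB ha, hb, fun e => hbB (e ▸ ha)⟩
  · rcases h.1 p hp with h1 | h1
    · exact offDiag_mono hB h1
    · exact offDiag_mono sdiff_subset h1
  · intro C hCA hne hC
    have hC' : IsSaturated C l := fun q hq => hC q (List.mem_cons_of_mem _ hq)
    have hab : a ∈ C ↔ b ∈ C := hC (a, b) List.mem_cons_self
    have hbAB : b ∈ A \ B := mem_sdiff.mpr ⟨hb, hbB⟩
    have hl : ∀ x ∈ C, a ∈ C := by
      intro x hx
      by_cases hxB : x ∈ B
      · exact h.eq_of_isSaturated hC' hxB hx ha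
      · exact hab.mpr ((h.symm hB).eq_of_isSaturated hC' (mem_sdiff.mpr ⟨hCA hx, hxB⟩) hx hbAB)
    obtain ⟨x, hx⟩ := hne
    have haC := hl x hx
    refine hCA.antisymm fun y hy => ?_
    by_cases hyB : y ∈ B
    · exact h.eq_of_isSaturated hC' ha haC hyB
    · exact (h.symm hB).eq_of_isSaturated hC' hbAB (hab.mp haC) (mem_sdiff.mpr ⟨hy, hyB⟩)

theorem isConnectedOn_filter_of_cons {A B : Finset X} {a b : X} {l : List (X × X)}
    (h : ∀ C ⊆ A, C.Nonempty → (a ∈ C ↔ b ∈ C) → IsSaturated C l → C = A)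
    (hl : ∀ p ∈ l, p ∈ A.offDiag) (hB : B ⊆ A) (ha : a ∈ B) (hb : b ∈ A) (hbB : b ∉ B)
    (hBs : IsSaturated B l) : IsConnectedOn B (l.filter (· ∈ B.offDiag)) := by
  refine ⟨⟨a, ha⟩, fun p hp => by simpa using (List.mem_filter.mp hp).2, ?_⟩
  intro D hD hne hDs
  have hDl : IsSaturated D l := by
    intro p hp
    by_cases hpB : p ∈ B.offDiag
    · exact hDs p (List.mem_filter.mpr ⟨hp, by simpa using hpB⟩)
    · have h1 := hBs p hp
      have h2 := hl p hp
      simp only [mem_offDiag] at h2 hpB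
      have h3 := @hD p.1
      have h4 := @hD p.2
      tauto
  by_cases haD : a ∈ D
  · have hU : D ∪ (A \ B) = A := by
      refine h _ (union_subset (hD.trans hB) sdiff_subset) (hne.mono subset_union_left) ?_ ?_
      · simp [haD, hb, hbB]
      · intro p hp
        have h1 := hBs p hp
        have h2 := hl p hp
        have h3 := hDl p hp
        simp only [mem_offDiag] at h2
        simp only [mem_union, mem_sdiff]
        tauto
    refine hD.antisymm fun y hy => ?_
    have : y ∈ D ∪ (A \ B) := by rw [hU]; exact hB hy
    simpa [hy] using this
  · have := h D (hD.trans hB) hne (by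
      have : b ∉ D := fun h => hbB (hD h)
      tauto) hDl
    exact absurd (hD (this ▸ hb)) hbB

theorem exists_isSplitting {A : Finset X} {a b : X} {l : List (X × X)}
    (h : IsConnectedOn A ((a, b) :: l)) (h' : ¬IsConnectedOn A l) :
    ∃ B ⊆ A, a ∈ B ∧ b ∉ B ∧ IsSplitting A B l := by
  have hl : ∀ p ∈ l, p ∈ A.offDiag := fun p hp => h.2.1 p (List.mem_cons_of_mem _ hp)
  have hab : (a, b) ∈ A.offDiag := h.2.1 _ List.mem_cons_self
  simp only [mem_offDiag] at hab
  have hc : ∀ C ⊆ A, C.Nonempty → (a ∈ C ↔ b ∈ C) → IsSaturated C l → C = A :=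
    fun C hC hne hiff hs => h.2.2 C hC hne (List.forall_mem_cons.mpr ⟨hiff, hs⟩)
  have hcompl : ∀ C ⊆ A, IsSaturated C l → IsSaturated (A \ C) l := by
    intro C hC hs p hp
    have h1 := hs p hp
    have h2 := hl p hp
    simp only [mem_offDiag] at h2
    simp only [mem_sdiff]
    tauto
  obtain ⟨B, hBA, haB, hbB, hBs⟩ : ∃ B ⊆ A, a ∈ B ∧ b ∉ B ∧ IsSaturated B l := by
    have : ∃ C ⊆ A, C.Nonempty ∧ IsSaturated C l ∧ C ≠ A := by
      by_contra hcon
      push Not at hcon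
      exact h' ⟨h.1, hl, fun B hB hne hs => hcon B hB hne hs⟩
    obtain ⟨C, hCA, hne, hCs, hCne⟩ := this
    have hiff : ¬(a ∈ C ↔ b ∈ C) := fun e => hCne (hc C hCA hne e hCs)
    by_cases haC : a ∈ C
    · exact ⟨C, hCA, haC, by tauto, hCs⟩
    · refine ⟨A \ C, sdiff_subset, by simp [hab.1, haC], ?_, hcompl C hCA hCs⟩
      simp only [mem_sdiff]
      tauto
  refine ⟨B, hBA, haB, hbB, ?_, ?_, ?_⟩
  · intro p hp
    have h1 := hBs p hp
    have h2 := hl p hp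
    simp only [mem_offDiag, mem_sdiff] at h2 ⊢
    tauto
  · exact isConnectedOn_filter_of_cons hc hl hBA haB hab.2.1 hbB hBs
  · exact isConnectedOn_filter_of_cons (a := b) (b := a)
      (fun C hC hne e hs => hc C hC hne e.symm hs) hl sdiff_subset
      (mem_sdiff.mpr ⟨hab.2.1, hbB⟩) hab.1 (by simp [haB]) (hcompl B hBA hBs)

theorem ind_isFactorizationOn_cons {A : Finset X} (ρ : Equiv.Perm X) {a b : X}
    (hab : (a, b) ∈ A.offDiag) (l : List (X × X)) :
    ind (IsFactorizationOn A ρ ((a, b) :: l)) =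
      ind (IsFactorizationOn A (Equiv.swap a b * ρ) l) +
      ∑ B ∈ A.powerset with a ∈ B ∧ b ∉ B,
        ind (∀ p ∈ l, p ∈ B.offDiag ∨ p ∈ (A \ B).offDiag) *
          (ind (IsFactorizationOn B (Equiv.swap a b * ρ) (l.filter (· ∈ B.offDiag))) *
           ind (IsFactorizationOn (A \ B) (Equiv.swap a b * ρ)
            (l.filter (· ∈ (A \ B).offDiag)))) := by
  have habA := mem_offDiag.mp hab
  have hprod : ∀ x, wordProd ((a, b) :: l) x = ρ x ↔ wordProd l x = (Equiv.swap a b * ρ) x := by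
    intro x
    rw [wordProd_cons, Equiv.Perm.mul_apply, Equiv.Perm.mul_apply, ← Equiv.eq_symm_apply,
      Equiv.symm_swap]
  have hterm : ∀ B, B ⊆ A → a ∈ B ∧ b ∉ B →
      ind (∀ p ∈ l, p ∈ B.offDiag ∨ p ∈ (A \ B).offDiag) *
          (ind (IsFactorizationOn B (Equiv.swap a b * ρ) (l.filter (· ∈ B.offDiag))) *
           ind (IsFactorizationOn (A \ B) (Equiv.swap a b * ρ)
            (l.filter (· ∈ (A \ B).offDiag)))) =
      ind (IsSplitting A B l ∧ ∀ x ∈ A, wordProd l x = (Equiv.swap a b * ρ) x) := by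
    intro B hB _
    rw [← ind_and, ← ind_and]
    congr 1
    simp only [IsSplitting, IsFactorizationOn, eq_iff_iff]
    constructor
    · rintro ⟨h1, ⟨h2, h3⟩, h4, h5⟩
      refine ⟨⟨h1, h2, h4⟩, fun x hx => ?_⟩
      by_cases hxB : x ∈ B
      · rw [← h3 x hxB, wordProd_filter_apply _ hxB]
        intro p hp
        have := h1 p hp
        simp only [mem_offDiag, mem_sdiff] at this ⊢
        tauto
      · have hxAB : x ∈ A \ B := mem_sdiff.mpr ⟨hx, hxB⟩
        rw [← h5 x hxAB, wordProd_filter_apply _ hxAB]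
        intro p hp
        have := h1 p hp
        simp only [mem_offDiag, mem_sdiff] at this ⊢
        tauto
    · rintro ⟨⟨h1, h2, h4⟩, h⟩
      refine ⟨h1, ⟨h2, fun x hx => ?_⟩, h4, fun x hx => ?_⟩
      · rw [← h x (hB hx), wordProd_filter_apply _ hx]
        intro p hp
        have := h1 p hp
        simp only [mem_offDiag, mem_sdiff] at this ⊢
        tauto
      · rw [← h x (sdiff_subset hx), wordProd_filter_apply _ hx]
        intro p hp
        have := h1 p hp
        simp only [mem_offDiag, mem_sdiff] at this ⊢
        tauto
  rw [sum_congr (g := fun B => ind (IsSplitting A B l ∧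
      ∀ x ∈ A, wordProd l x = (Equiv.swap a b * ρ) x)) rfl fun B hB => by
    rw [mem_filter, mem_powerset] at hB
    exact hterm B hB.1 hB.2]
  simp only [IsFactorizationOn, hprod]
  by_cases hagree : ∀ x ∈ A, wordProd l x = (Equiv.swap a b * ρ) x
  swap
  · rw [ind_of_false fun h => hagree h.2, ind_of_false fun h => hagree h.2,
      sum_eq_zero fun B _ => ind_of_false fun h => hagree h.2, add_zero]
  by_cases hA : IsConnectedOn A l
  · rw [ind_of_true ⟨hA.cons hab, hagree⟩, ind_of_true ⟨hA, hagree⟩, sum_eq_zero, add_zero]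
    intro B hB
    rw [mem_filter, mem_powerset] at hB
    rw [ind_of_false]
    exact fun h => h.1.not_isConnectedOn hB.1 habA.2.1 hB.2.2 hA
  rw [ind_of_false (P := IsConnectedOn A l ∧ _) fun h => hA h.1, zero_add]
  by_cases hA' : IsConnectedOn A ((a, b) :: l)
  · obtain ⟨B, hBA, haB, hbB, hsplit⟩ := exists_isSplitting hA' hA
    rw [ind_of_true ⟨hA', hagree⟩, sum_eq_single_of_mem B (by simp [hBA, haB, hbB]), ind_of_true ⟨hsplit, hagree⟩]
    intro B' hB' hne
    rw [mem_filter, mem_powerset] at hB'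
    refine ind_of_false fun h => hne ?_
    exact (h.1.eq_of_isSaturated hsplit.isSaturated hB'.2.1 haB).antisymm
      (hsplit.eq_of_isSaturated h.1.isSaturated haB hB'.2.1)
  · rw [ind_of_false fun h => hA' h.1, sum_eq_zero]
    intro B hB
    rw [mem_filter, mem_powerset] at hB
    exact ind_of_false fun h => hA' (h.1.isConnectedOn_cons hB.1 hB.2.1 habA.2.1 hB.2.2)

variable [Fintype X]

/-- The number of words of length `r` that are connected factorizations of `ρ` on `A`. -/
noncomputable def numFactorizations (A : Finset X) (ρ : Equiv.Perm X) (r : ℕ) : ℝ :=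
  wordSum r fun l => ind (IsFactorizationOn A ρ l)

theorem numFactorizations_succ (A : Finset X) (ρ : Equiv.Perm X) (r : ℕ) :
    numFactorizations A ρ (r + 1) = ∑ p ∈ A.offDiag,
      (numFactorizations A (Equiv.swap p.1 p.2 * ρ) r +
        ∑ B ∈ A.powerset with p.1 ∈ B ∧ p.2 ∉ B, ∑ ij ∈ antidiagonal r, (r.choose ij.1 : ℝ) *
          (numFactorizations B (Equiv.swap p.1 p.2 * ρ) ij.1 *
            numFactorizations (A \ B) (Equiv.swap p.1 p.2 * ρ) ij.2)) := by
  have hwithin : ∀ (B : Finset X) (π : Equiv.Perm X) (l : List (X × X)),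
      ind (∀ p ∈ l, p ∈ B.offDiag) * ind (IsFactorizationOn B π l) =
        ind (IsFactorizationOn B π l) := by
    intro B π l
    rw [← ind_and]
    congr 1
    exact propext ⟨fun h => h.2, fun h => ⟨h.1.2.1, h⟩⟩
  rw [numFactorizations, wordSum_succ, ← sum_subset (subset_univ A.offDiag)]
  · refine sum_congr rfl fun p hp => ?_
    obtain ⟨a, b⟩ := p
    simp only [ind_isFactorizationOn_cons ρ hp]
    rw [wordSum_add, wordSum_sum]
    congr 1
    refine sum_congr rfl fun B hB => ?_
    rw [wordSum_shuffle (· ∈ B.offDiag) (· ∈ (A \ B).offDiag) (by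
      intro p h1 h2
      simp only [mem_offDiag, mem_sdiff] at h1 h2
      tauto) r (fun l => ind (IsFactorizationOn B (Equiv.swap a b * ρ) l))
      (fun l => ind (IsFactorizationOn (A \ B) (Equiv.swap a b * ρ) l))]
    simp only [hwithin]
    rfl
  · intro p _ hp
    exact wordSum_eq_zero fun l => ind_of_false fun h => hp (h.1.2.1 p List.mem_cons_self)

theorem apply_mem_of_numFactorizations_ne_zero {A : Finset X} {ρ : Equiv.Perm X} {r : ℕ}
    (h : numFactorizations A ρ r ≠ 0) : A.Nonempty ∧ ∀ x ∈ A, ρ x ∈ A := by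
  obtain ⟨l, hl⟩ : ∃ l, IsFactorizationOn A ρ l := by
    by_contra hcon
    push Not at hcon
    exact h (wordSum_eq_zero fun l => ind_of_false (hcon l))
  refine ⟨hl.1.1, fun x hx => ?_⟩
  rw [← hl.2 x hx]
  refine wordProd_apply_mem (fun p hp => ?_) hx
  have := hl.1.2.1 p hp
  simp only [mem_offDiag] at this
  tauto

theorem numFactorizations_zero (A : Finset X) (ρ : Equiv.Perm X) (hρ : ∀ x ∈ A, ρ x ∈ A) :
    numFactorizations A ρ 0 = if #A = 1 then 1 else 0 := by
  rw [numFactorizations, wordSum_zero]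
  split_ifs with h
  · obtain ⟨a, rfl⟩ := card_eq_one.mp h
    refine ind_of_true ⟨⟨singleton_nonempty a, by simp, fun B hB hne _ => ?_⟩, ?_⟩
    · exact (subset_singleton_iff.mp hB).resolve_left hne.ne_empty
    · intro x hx
      have := hρ x hx
      rw [mem_singleton] at hx this
      rw [this, hx]; rfl
  · refine ind_of_false fun hf => h ?_
    obtain ⟨a, ha⟩ := hf.1.1
    rw [← hf.1.2.2 {a} (by simpa) (singleton_nonempty a) (by intro p hp; simp at hp)]
    simp

end Splitting

section Cycles

variable {X : Type*} [DecidableEq X] [Fintype X] {ρ : Equiv.Perm X}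

/-- The cycle of `ρ` through `x`, as a finite set (a singleton if `x` is a fixed point). -/
def cyc (ρ : Equiv.Perm X) (x : X) : Finset X := univ.filter (ρ.SameCycle x)

theorem mem_cyc {x y : X} : y ∈ cyc ρ x ↔ ρ.SameCycle x y := by simp [cyc]

theorem self_mem_cyc (ρ : Equiv.Perm X) (x : X) : x ∈ cyc ρ x := mem_cyc.mpr (.refl ρ x)

theorem cyc_eq_cyc {x y : X} : cyc ρ x = cyc ρ y ↔ ρ.SameCycle x y := by
  constructor
  · intro h
    exact mem_cyc.mp (h ▸ self_mem_cyc ρ y)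
  · intro h
    ext z
    rw [mem_cyc, mem_cyc]
    exact ⟨fun hz => h.symm.trans hz, fun hz => h.trans hz⟩

theorem cyc_eq_of_mem {x y : X} (h : y ∈ cyc ρ x) : cyc ρ y = cyc ρ x :=
  (cyc_eq_cyc.mpr (mem_cyc.mp h)).symm

theorem pow_apply_mem_cyc (ρ : Equiv.Perm X) (i : ℕ) (x : X) : (ρ ^ i) x ∈ cyc ρ x :=
  mem_cyc.mpr ⟨i, by simp⟩

theorem pow_apply_injOn {k : ℕ} {a : X} (h : ∀ i, 0 < i → i < k → (ρ ^ i) a ≠ a) :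
    Set.InjOn (fun i : ℕ => (ρ ^ i) a) (range k) := by
  have key : ∀ i j, i < j → j < k → (ρ ^ i) a ≠ (ρ ^ j) a := by
    intro i j hij hj he
    obtain ⟨m, rfl⟩ : ∃ m, j = i + m := ⟨j - i, by omega⟩
    rw [pow_add, Equiv.Perm.mul_apply] at he
    exact h m (by omega) (by omega) ((ρ ^ i).injective he).symm
  intro i hi j hj he
  simp only [coe_range, Set.mem_Iio] at hi hj
  rcases lt_trichotomy i j with hij | hij | hij
  · exact absurd he (key i j hij hj)
  · exact hij
  · exact absurd he.symm (key j i hij hi)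

theorem cyc_eq_image {k : ℕ} {a : X} (hk : 0 < k) (ha : (ρ ^ k) a = a) :
    cyc ρ a = (range k).image fun i => (ρ ^ i) a := by
  ext y
  simp only [mem_image, mem_range]
  constructor
  · intro hy
    obtain ⟨n, rfl⟩ := (mem_cyc.mp hy).exists_nat_pow_eq
    refine ⟨n % k, Nat.mod_lt _ hk, ?_⟩
    have hfix : ∀ m : ℕ, ((ρ ^ k) ^ m) a = a := by
      intro m
      induction m with
      | zero => simp
      | succ m ih => rw [pow_succ, Equiv.Perm.mul_apply, ha, ih]
    conv_rhs => rw [← Nat.mod_add_div n k, pow_add, pow_mul, Equiv.Perm.mul_apply, hfix]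
  · rintro ⟨i, _, rfl⟩
    exact pow_apply_mem_cyc ρ i a

theorem card_cyc_eq {k : ℕ} {a : X} (hk : 0 < k) (ha : (ρ ^ k) a = a)
    (h : ∀ i, 0 < i → i < k → (ρ ^ i) a ≠ a) : #(cyc ρ a) = k := by
  rw [cyc_eq_image hk ha, card_image_of_injOn (pow_apply_injOn h), card_range]

theorem card_cyc_spec (ρ : Equiv.Perm X) (a : X) : 0 < #(cyc ρ a) ∧ (ρ ^ #(cyc ρ a)) a = a ∧
    ∀ i, 0 < i → i < #(cyc ρ a) → (ρ ^ i) a ≠ a := by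
  have hex : ∃ k, 0 < k ∧ (ρ ^ k) a = a := ⟨orderOf ρ, orderOf_pos ρ, by simp [pow_orderOf_eq_one]⟩
  classical
  have hmin : ∀ i, 0 < i → i < Nat.find hex → (ρ ^ i) a ≠ a := fun i hi hlt he =>
    Nat.find_min hex hlt ⟨hi, he⟩
  obtain ⟨h1, h2⟩ := Nat.find_spec hex
  rw [card_cyc_eq h1 h2 hmin]
  exact ⟨h1, h2, hmin⟩

theorem sum_cyc_erase {M : Type*} [AddCommMonoid M] (ρ : Equiv.Perm X) (a : X) (h : X → M) :
    ∑ b ∈ (cyc ρ a).erase a, h b = ∑ j ∈ Ico 1 #(cyc ρ a), h ((ρ ^ j) a) := by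
  obtain ⟨h1, h2, h3⟩ := card_cyc_spec ρ a
  have hinj := pow_apply_injOn h3
  have : (cyc ρ a).erase a = (Ico 1 #(cyc ρ a)).image fun i => (ρ ^ i) a := by
    rw [cyc_eq_image h1 h2, ← cyc_eq_image h1 h2]
    ext y
    simp only [mem_erase, mem_image, mem_Ico]
    constructor
    · rintro ⟨hne, hy⟩
      rw [cyc_eq_image h1 h2, mem_image] at hy
      obtain ⟨i, hi, rfl⟩ := hy
      refine ⟨i, ⟨Nat.one_le_iff_ne_zero.mpr ?_, mem_range.mp hi⟩, rfl⟩
      rintro rfl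
      exact hne rfl
    · rintro ⟨i, ⟨hi, hi'⟩, rfl⟩
      exact ⟨h3 i hi hi', pow_apply_mem_cyc ρ i a⟩
  rw [this, sum_image]
  exact hinj.mono fun i hi => by simp at hi ⊢; omega

/-- The powers of `ρ` and of `swap a b * ρ` agree on `x` until the orbit of `x` hits `a` or `b`. -/
theorem swap_mul_pow_apply (a b x : X) (m : ℕ)
    (h : ∀ i, 0 < i → i ≤ m → (ρ ^ i) x ≠ a ∧ (ρ ^ i) x ≠ b) :
    ((Equiv.swap a b * ρ) ^ m) x = (ρ ^ m) x := by
  induction m with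
  | zero => rfl
  | succ m ih =>
    have h1 := h (m + 1) (by omega) le_rfl
    rw [pow_succ', Equiv.Perm.mul_apply, ih fun i hi hm => h i hi (by omega),
      Equiv.Perm.mul_apply, ← Equiv.Perm.mul_apply ρ, ← pow_succ',
      Equiv.swap_apply_of_ne_of_ne h1.1 h1.2]

theorem swap_mul_pow_succ_apply (a b x : X) (m : ℕ)
    (h : ∀ i, 0 < i → i ≤ m → (ρ ^ i) x ≠ a ∧ (ρ ^ i) x ≠ b) :
    ((Equiv.swap a b * ρ) ^ (m + 1)) x = Equiv.swap a b ((ρ ^ (m + 1)) x) := by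
  rw [pow_succ', Equiv.Perm.mul_apply, swap_mul_pow_apply a b x m h, pow_succ' ρ]
  rfl

theorem cyc_swap_mul_of_notMem {a b x : X} (ha : x ∉ cyc ρ a) (hb : x ∉ cyc ρ b) :
    cyc (Equiv.swap a b * ρ) x = cyc ρ x := by
  obtain ⟨h1, h2, -⟩ := card_cyc_spec ρ x
  have hne : ∀ i, (ρ ^ i) x ≠ a ∧ (ρ ^ i) x ≠ b := by
    refine fun i => ⟨fun h => ha ?_, fun h => hb ?_⟩ <;> rw [mem_cyc] <;> symm <;>
      exact ⟨i, by simpa using h⟩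
  have hpow : ∀ i, ((Equiv.swap a b * ρ) ^ i) x = (ρ ^ i) x := fun i =>
    swap_mul_pow_apply a b x i fun j _ _ => hne j
  rw [cyc_eq_image h1 h2, cyc_eq_image h1 (by rw [hpow, h2])]
  simp only [hpow]

theorem card_cyc_swap_mul_left {a : X} {j : ℕ} (hj : 0 < j) (hjk : j < #(cyc ρ a)) :
    #(cyc (Equiv.swap a ((ρ ^ j) a) * ρ) a) = j ∧
      cyc (Equiv.swap a ((ρ ^ j) a) * ρ) a = (range j).image fun i => (ρ ^ i) a := by
  obtain ⟨h1, h2, h3⟩ := card_cyc_spec ρ a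
  have hinj := pow_apply_injOn h3
  have hne : ∀ i, 0 < i → i ≤ j - 1 → (ρ ^ i) a ≠ a ∧ (ρ ^ i) a ≠ (ρ ^ j) a := by
    refine fun i hi hij => ⟨h3 i hi (by omega), fun h => ?_⟩
    have := hinj (by simp; omega) (by simp; omega) h
    omega
  have hpow : ∀ i, i ≤ j - 1 → ((Equiv.swap a ((ρ ^ j) a) * ρ) ^ i) a = (ρ ^ i) a := fun i hi =>
    swap_mul_pow_apply _ _ a i fun i' h h' => hne i' h (by omega)
  have hj' : ((Equiv.swap a ((ρ ^ j) a) * ρ) ^ j) a = a := by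
    have := swap_mul_pow_succ_apply a ((ρ ^ j) a) a (j - 1) hne
    rwa [Nat.sub_add_cancel hj, Equiv.swap_apply_right] at this
  refine ⟨card_cyc_eq hj hj' fun i hi hij => ?_, ?_⟩
  · rw [hpow i (by omega)]
    exact h3 i hi (by omega)
  · rw [cyc_eq_image hj hj']
    refine image_congr fun i hi => ?_
    simp only [coe_range, Set.mem_Iio] at hi
    exact hpow i (by omega)

/-- Multiplying by a transposition of two points of one cycle cuts the cycle in two. -/
theorem cyc_swap_mul_cut {a b : X} {j : ℕ} (hj : 0 < j) (hjk : j < #(cyc ρ a))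
    (hb : (ρ ^ j) a = b) :
    #(cyc (Equiv.swap a b * ρ) a) = j ∧ #(cyc (Equiv.swap a b * ρ) b) = #(cyc ρ a) - j ∧
      Disjoint (cyc (Equiv.swap a b * ρ) a) (cyc (Equiv.swap a b * ρ) b) ∧
      cyc (Equiv.swap a b * ρ) a ∪ cyc (Equiv.swap a b * ρ) b = cyc ρ a := by
  obtain ⟨h1, h2, h3⟩ := card_cyc_spec ρ a
  have hinj := pow_apply_injOn h3
  obtain ⟨ha1, ha2⟩ := card_cyc_swap_mul_left hj hjk
  have hcyc : cyc ρ b = cyc ρ a := cyc_eq_of_mem (hb ▸ pow_apply_mem_cyc ρ j a)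
  have hba : (ρ ^ (#(cyc ρ a) - j)) b = a := by
    rw [← hb, ← Equiv.Perm.mul_apply, ← pow_add, Nat.sub_add_cancel hjk.le, h2]
  have hb12 := card_cyc_swap_mul_left (ρ := ρ) (a := b) (j := #(cyc ρ a) - j) (by omega)
    (by rw [hcyc]; omega)
  rw [hba, Equiv.swap_comm] at hb12
  obtain ⟨hb1, hb2⟩ := hb12
  rw [hb] at ha1 ha2
  have hpowb : ∀ i, (ρ ^ i) b = (ρ ^ (j + i)) a := by
    intro i
    rw [← hb, ← Equiv.Perm.mul_apply, ← pow_add, add_comm]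
  refine ⟨ha1, hb1, ?_, ?_⟩
  · rw [ha2, hb2, disjoint_left]
    intro y hy hy'
    simp only [mem_image, mem_range] at hy hy'
    obtain ⟨i, hi, rfl⟩ := hy
    obtain ⟨i', hi', he⟩ := hy'
    rw [hpowb] at he
    have := hinj (by simp; omega) (by simp; omega) he
    omega
  · have him := cyc_eq_image h1 h2
    generalize #(cyc ρ a) = k at *
    rw [ha2, hb2, him]
    ext y
    simp only [mem_union, mem_image, mem_range, hpowb]
    constructor
    · rintro (⟨i, hi, rfl⟩ | ⟨i, hi, rfl⟩)
      · exact ⟨i, by omega, rfl⟩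
      · exact ⟨j + i, by omega, rfl⟩
    · rintro ⟨i, hi, rfl⟩
      by_cases hij : i < j
      · exact .inl ⟨i, hij, rfl⟩
      · exact .inr ⟨i - j, by omega, by rw [Nat.add_sub_cancel' (by omega)]⟩

/-- Multiplying by a transposition of points of two different cycles joins the two cycles. -/
theorem cyc_swap_mul_join {a b : X} (h : cyc ρ a ≠ cyc ρ b) :
    cyc (Equiv.swap a b * ρ) a = cyc ρ a ∪ cyc ρ b ∧
      cyc (Equiv.swap a b * ρ) b = cyc ρ a ∪ cyc ρ b ∧ Disjoint (cyc ρ a) (cyc ρ b) := by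
  have hab : ¬ρ.SameCycle a b := fun hs => h (cyc_eq_cyc.mpr hs)
  obtain ⟨h1, h2, h3⟩ := card_cyc_spec ρ a
  have hπ : ((Equiv.swap a b * ρ) ^ #(cyc ρ a)) a = b := by
    have := swap_mul_pow_succ_apply a b a (#(cyc ρ a) - 1) fun i hi hik =>
      ⟨h3 i hi (by omega), fun he => hab ⟨i, by simpa using he⟩⟩
    rwa [Nat.sub_add_cancel h1, h2, Equiv.swap_apply_left] at this
  have hmem : b ∈ cyc (Equiv.swap a b * ρ) a := by
    have := pow_apply_mem_cyc (Equiv.swap a b * ρ) #(cyc ρ a) a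
    rwa [hπ] at this
  have hne : b ≠ a := fun e => h (by rw [e])
  have hmem' := hmem
  obtain ⟨g1, g2, g3⟩ := card_cyc_spec (Equiv.swap a b * ρ) a
  rw [cyc_eq_image g1 g2, mem_image] at hmem'
  obtain ⟨j, hj, hjb⟩ := hmem'
  have hj0 : 0 < j := by
    rcases Nat.eq_zero_or_pos j with rfl | hj0
    · exact absurd hjb.symm hne
    · exact hj0
  obtain ⟨-, -, c3, c4⟩ := cyc_swap_mul_cut hj0 (mem_range.mp hj) hjb
  rw [Equiv.swap_mul_self_mul] at c3 c4
  exact ⟨c4.symm, by rw [cyc_eq_of_mem hmem, c4], c3⟩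

/-- The set of cycles of `ρ` meeting `A`. -/
def cycs (ρ : Equiv.Perm X) (A : Finset X) : Finset (Finset X) := A.image (cyc ρ)

theorem cyc_mem_cycs {A : Finset X} {x : X} (hx : x ∈ A) : cyc ρ x ∈ cycs ρ A :=
  mem_image_of_mem _ hx

theorem cyc_subset {A : Finset X} (hA : ∀ x ∈ A, ρ x ∈ A) {x : X} (hx : x ∈ A) : cyc ρ x ⊆ A := by
  intro y hy
  obtain ⟨n, rfl⟩ := (mem_cyc.mp hy).exists_nat_pow_eq
  clear hy
  induction n with
  | zero => simpa
  | succ n ih => rw [pow_succ', Equiv.Perm.mul_apply]; exact hA _ ih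

theorem cyc_mem_cycs_iff {A : Finset X} (hA : ∀ x ∈ A, ρ x ∈ A) {x : X} :
    cyc ρ x ∈ cycs ρ A ↔ x ∈ A := by
  refine ⟨fun h => ?_, cyc_mem_cycs⟩
  obtain ⟨y, hy, he⟩ := mem_image.mp h
  exact cyc_subset hA hy (he ▸ self_mem_cyc ρ x)

theorem eq_cyc_of_mem_cycs {A C : Finset X} (hC : C ∈ cycs ρ A) {x : X} (hx : x ∈ C) :
    cyc ρ x = C := by
  obtain ⟨y, _, rfl⟩ := mem_image.mp hC
  exact cyc_eq_of_mem hx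

theorem nonempty_of_mem_cycs {A C : Finset X} (hC : C ∈ cycs ρ A) : C.Nonempty := by
  obtain ⟨y, _, rfl⟩ := mem_image.mp hC
  exact ⟨y, self_mem_cyc ρ y⟩

theorem pairwiseDisjoint_cycs {A : Finset X} :
    Set.PairwiseDisjoint (cycs ρ A : Set (Finset X)) id := by
  intro C hC D hD hne
  refine disjoint_left.mpr fun x hxC hxD => hne ?_
  rw [← eq_cyc_of_mem_cycs hC hxC, eq_cyc_of_mem_cycs hD hxD]

theorem biUnion_cycs {A : Finset X} (hA : ∀ x ∈ A, ρ x ∈ A) : (cycs ρ A).biUnion id = A := by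
  ext x
  simp only [mem_biUnion, id]
  constructor
  · rintro ⟨C, hC, hx⟩
    rw [← eq_cyc_of_mem_cycs hC hx, cyc_mem_cycs_iff hA] at hC
    exact hC
  · exact fun hx => ⟨_, cyc_mem_cycs hx, self_mem_cyc ρ x⟩

theorem cycs_biUnion {A : Finset X} {S : Finset (Finset X)} (hS : S ⊆ cycs ρ A) :
    cycs ρ (S.biUnion id) = S := by
  ext C
  simp only [cycs, mem_image, mem_biUnion, id]
  constructor
  · rintro ⟨x, ⟨D, hD, hx⟩, rfl⟩
    rwa [eq_cyc_of_mem_cycs (hS hD) hx]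
  · intro hC
    obtain ⟨x, hx⟩ := nonempty_of_mem_cycs (hS hC)
    exact ⟨x, ⟨C, hC, hx⟩, eq_cyc_of_mem_cycs (hS hC) hx⟩

theorem apply_mem_biUnion {A : Finset X} {S : Finset (Finset X)} (hS : S ⊆ cycs ρ A) :
    ∀ x ∈ S.biUnion id, ρ x ∈ S.biUnion id := by
  intro x hx
  simp only [mem_biUnion, id] at hx ⊢
  obtain ⟨C, hC, hx⟩ := hx
  refine ⟨C, hC, ?_⟩
  rw [← eq_cyc_of_mem_cycs (hS hC) hx]
  exact pow_apply_mem_cyc ρ 1 x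

theorem apply_mem_sdiff {A B : Finset X} (hA : ∀ x ∈ A, ρ x ∈ A) (hB : ∀ x ∈ B, ρ x ∈ B) :
    ∀ x ∈ A \ B, ρ x ∈ A \ B := by
  intro x hx
  rw [mem_sdiff] at hx ⊢
  refine ⟨hA x hx.1, fun h => hx.2 ?_⟩
  refine cyc_subset hB h (mem_cyc.mpr ?_)
  exact Equiv.Perm.sameCycle_apply_left.mpr (.refl ρ x)

theorem cycs_sdiff {A B : Finset X} (hB : ∀ x ∈ B, ρ x ∈ B) :
    cycs ρ (A \ B) = cycs ρ A \ cycs ρ B := by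
  ext C
  rw [mem_sdiff]
  constructor
  · intro h
    obtain ⟨x, hx, rfl⟩ := mem_image.mp h
    rw [mem_sdiff] at hx
    exact ⟨cyc_mem_cycs hx.1, fun h => hx.2 ((cyc_mem_cycs_iff hB).mp h)⟩
  · rintro ⟨h, h'⟩
    obtain ⟨x, hx, rfl⟩ := mem_image.mp h
    exact cyc_mem_cycs (mem_sdiff.mpr ⟨hx, fun h => h' (cyc_mem_cycs h)⟩)

theorem sum_card_cycs {A : Finset X} (hA : ∀ x ∈ A, ρ x ∈ A) : ∑ C ∈ cycs ρ A, #C = #A := by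
  conv_rhs => rw [← biUnion_cycs hA, card_biUnion pairwiseDisjoint_cycs]
  rfl

theorem sum_comp_cyc {A : Finset X} (hA : ∀ x ∈ A, ρ x ∈ A) (h : Finset X → ℝ) :
    ∑ a ∈ A, h (cyc ρ a) = ∑ C ∈ cycs ρ A, (#C : ℝ) * h C := by
  rw [sum_comp h (cyc ρ)]
  refine sum_congr rfl fun C hC => ?_
  rw [nsmul_eq_mul]
  congr 3
  obtain ⟨y, hy, rfl⟩ := mem_image.mp hC
  ext x
  rw [mem_filter]
  exact ⟨fun h => h.2 ▸ self_mem_cyc ρ x, fun h => ⟨cyc_subset hA hy h, cyc_eq_of_mem h⟩⟩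

theorem apply_swap_mul_mem {A : Finset X} (hA : ∀ x ∈ A, ρ x ∈ A) {a b : X} (ha : a ∈ A)
    (hb : b ∈ A) : ∀ x ∈ A, (Equiv.swap a b * ρ) x ∈ A := by
  intro x hx
  rw [Equiv.Perm.mul_apply, Equiv.swap_apply_def]
  split_ifs
  exacts [hb, ha, hA x hx]

theorem cycs_swap_mul_cut {A : Finset X} (hA : ∀ x ∈ A, ρ x ∈ A) {a b : X} (ha : a ∈ A) {j : ℕ}
    (hj : 0 < j) (hjk : j < #(cyc ρ a)) (hb : (ρ ^ j) a = b) :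
    cycs (Equiv.swap a b * ρ) A =
      insert (cyc (Equiv.swap a b * ρ) a) (insert (cyc (Equiv.swap a b * ρ) b)
        ((cycs ρ A).erase (cyc ρ a))) := by
  obtain ⟨-, -, -, hu⟩ := cyc_swap_mul_cut hj hjk hb
  have hba : b ∈ cyc ρ a := hb ▸ pow_apply_mem_cyc ρ j a
  have hbA : b ∈ A := cyc_subset hA ha hba
  have hout : ∀ x, x ∉ cyc ρ a → cyc (Equiv.swap a b * ρ) x = cyc ρ x := fun x hx =>
    cyc_swap_mul_of_notMem hx (by rwa [cyc_eq_of_mem hba])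
  ext C
  simp only [mem_insert, mem_erase]
  constructor
  · intro h
    obtain ⟨x, hx, rfl⟩ := mem_image.mp h
    by_cases hxa : x ∈ cyc ρ a
    · rw [← hu, mem_union] at hxa
      rcases hxa with hxa | hxa
      · exact .inl (cyc_eq_of_mem hxa)
      · exact .inr (.inl (cyc_eq_of_mem hxa))
    · rw [hout x hxa]
      exact .inr (.inr ⟨fun e => hxa (e ▸ self_mem_cyc ρ x), cyc_mem_cycs hx⟩)
  · rintro (rfl | rfl | ⟨hne, h⟩)
    · exact cyc_mem_cycs ha
    · exact cyc_mem_cycs hbA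
    · obtain ⟨x, hx, rfl⟩ := mem_image.mp h
      rw [← hout x fun e => hne (cyc_eq_of_mem e)]
      exact cyc_mem_cycs hx

theorem cycs_swap_mul_join {A : Finset X} {a b : X} (ha : a ∈ A)
    (h : cyc ρ a ≠ cyc ρ b) : cycs (Equiv.swap a b * ρ) A =
      insert (cyc ρ a ∪ cyc ρ b) (((cycs ρ A).erase (cyc ρ a)).erase (cyc ρ b)) := by
  obtain ⟨h1, h2, -⟩ := cyc_swap_mul_join h
  ext C
  simp only [mem_insert, mem_erase]
  constructor
  · intro hC
    obtain ⟨x, hx, rfl⟩ := mem_image.mp hC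
    by_cases hxa : x ∈ cyc ρ a
    · exact .inl (h1 ▸ cyc_eq_of_mem (h1 ▸ mem_union_left _ hxa))
    by_cases hxb : x ∈ cyc ρ b
    · exact .inl (h1 ▸ cyc_eq_of_mem (h1 ▸ mem_union_right _ hxb))
    rw [cyc_swap_mul_of_notMem hxa hxb]
    exact .inr ⟨fun e => hxb (e ▸ self_mem_cyc ρ x), fun e => hxa (e ▸ self_mem_cyc ρ x),
      cyc_mem_cycs hx⟩
  · rintro (rfl | ⟨hb, ha, h⟩)
    · exact h1 ▸ cyc_mem_cycs ha
    · obtain ⟨x, hx, rfl⟩ := mem_image.mp h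
      rw [← cyc_swap_mul_of_notMem (fun e => ha (cyc_eq_of_mem e)) fun e => hb (cyc_eq_of_mem e)]
      exact cyc_mem_cycs hx

end Cycles

section Recursion

variable {X : Type*} [DecidableEq X] [Fintype X] {ρ : Equiv.Perm X}

/-- The product formula counting shortest connected factorizations of `ρ` on `A`, up to the
factor `2 ^ r * r!`. -/
noncomputable def factorizationWeight (A : Finset X) (ρ : Equiv.Perm X) : ℝ :=
  (#A : ℝ) ^ ((#(cycs ρ A) : ℤ) - 3) * ∏ C ∈ cycs ρ A, (#C : ℝ) * selfPow #C

theorem cycs_cyc (ρ : Equiv.Perm X) (a : X) : cycs ρ (cyc ρ a) = {cyc ρ a} := by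
  ext C
  rw [mem_singleton]
  constructor
  · intro h
    obtain ⟨x, hx, rfl⟩ := mem_image.mp h
    exact cyc_eq_of_mem hx
  · rintro rfl
    exact cyc_mem_cycs (self_mem_cyc ρ a)

theorem apply_mem_cyc (ρ : Equiv.Perm X) (a : X) : ∀ x ∈ cyc ρ a, ρ x ∈ cyc ρ a := fun x hx => by
  rw [← cyc_eq_of_mem hx]
  exact pow_apply_mem_cyc ρ 1 x

theorem factorizationWeight_swap_mul_join {A : Finset X} {a b : X} (ha : a ∈ A) (hb : b ∈ A)
    (hab : cyc ρ a ≠ cyc ρ b) :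
    factorizationWeight A (Equiv.swap a b * ρ) =
      (#A : ℝ) ^ ((#(cycs ρ A) : ℤ) - 4) *
        (((#(cyc ρ a) + #(cyc ρ b) : ℕ) : ℝ) * selfPow (#(cyc ρ a) + #(cyc ρ b)) *
          ∏ C ∈ ((cycs ρ A).erase (cyc ρ a)).erase (cyc ρ b), (#C : ℝ) * selfPow #C) := by
  obtain ⟨-, -, hdisj⟩ := cyc_swap_mul_join hab
  have hnot : cyc ρ a ∪ cyc ρ b ∉ ((cycs ρ A).erase (cyc ρ a)).erase (cyc ρ b) := by
    intro h
    simp only [mem_erase] at h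
    exact h.2.1 (eq_cyc_of_mem_cycs h.2.2 (mem_union_left _ (self_mem_cyc ρ a))).symm
  have hbmem : cyc ρ b ∈ (cycs ρ A).erase (cyc ρ a) := mem_erase.mpr ⟨hab.symm, cyc_mem_cycs hb⟩
  have h1 := card_erase_add_one (cyc_mem_cycs (ρ := ρ) ha)
  have h2 := card_erase_add_one hbmem
  rw [factorizationWeight, cycs_swap_mul_join ha hab, prod_insert hnot, card_insert_of_notMem hnot,
    card_union_of_disjoint hdisj, h2]
  congr 2
  omega

theorem sum_factorizationWeight_cut {A : Finset X} (hA : ∀ x ∈ A, ρ x ∈ A) {a b : X} (ha : a ∈ A)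
    {j : ℕ} (hj : 0 < j) (hjk : j < #(cyc ρ a)) (hb : (ρ ^ j) a = b) :
    ∑ B ∈ A.powerset with (a ∈ B ∧ b ∉ B) ∧ ∀ x ∈ B, (Equiv.swap a b * ρ) x ∈ B,
        factorizationWeight B (Equiv.swap a b * ρ) *
          factorizationWeight (A \ B) (Equiv.swap a b * ρ) =
      ∑ S ∈ ((cycs ρ A).erase (cyc ρ a)).powerset,
        ((j : ℝ) + ∑ C ∈ S, (#C : ℝ)) ^ ((#S : ℤ) - 2) *
        (((#(cyc ρ a) - j : ℕ) : ℝ) + ∑ C ∈ (cycs ρ A).erase (cyc ρ a) \ S, (#C : ℝ)) ^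
          ((#((cycs ρ A).erase (cyc ρ a) \ S) : ℤ) - 2) *
        (j * selfPow j * ((#(cyc ρ a) - j : ℕ) * selfPow (#(cyc ρ a) - j))) *
          ∏ C ∈ (cycs ρ A).erase (cyc ρ a), (#C : ℝ) * selfPow #C := by
  have hba : b ∈ cyc ρ a := hb ▸ pow_apply_mem_cyc ρ j a
  have hπA := apply_swap_mul_mem hA ha (cyc_subset hA ha hba)
  have hK := cycs_swap_mul_cut hA ha hj hjk hb
  obtain ⟨hc1, hc2, hdisj, hunion⟩ := cyc_swap_mul_cut hj hjk hb
  set π := Equiv.swap a b * ρ with hπ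
  set J := (cycs ρ A).erase (cyc ρ a) with hJ
  have hne : cyc π a ≠ cyc π b := fun e =>
    disjoint_left.mp hdisj (self_mem_cyc π a) (e ▸ self_mem_cyc π a)
  have hnot : ∀ x ∈ cyc ρ a, cyc π x ∉ J := by
    intro x hx h
    rw [hJ, mem_erase] at h
    exact h.1 (by rw [← eq_cyc_of_mem_cycs h.2 (self_mem_cyc π x), cyc_eq_of_mem hx])
  have h1 : cyc π a ∉ J := hnot a (self_mem_cyc ρ a)
  have h2 : cyc π b ∉ J := hnot b hba
  have hJK : ∀ S ⊆ J, insert (cyc π a) S ⊆ cycs π A := by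
    intro S hS
    rw [hK]
    exact insert_subset_insert _ (hS.trans (subset_insert _ _))
  have hprod : ∏ C ∈ cycs π A, (#C : ℝ) * selfPow #C =
      (j * selfPow j * ((#(cyc ρ a) - j : ℕ) * selfPow (#(cyc ρ a) - j))) *
          ∏ C ∈ J, (#C : ℝ) * selfPow #C := by
    rw [hK, prod_insert, prod_insert h2, hc1, hc2]
    · ring
    · simp [hne, h1]
  refine sum_bij' (fun B _ => (cycs π B).erase (cyc π a))
    (fun S _ => (insert (cyc π a) S).biUnion id) ?_ ?_ ?_ ?_ ?_
  · intro B hB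
    simp only [mem_filter, mem_powerset] at hB ⊢
    obtain ⟨hBA, ⟨haB, hbB⟩, hBπ⟩ := hB
    intro C hC
    rw [mem_erase] at hC
    have hCK : C ∈ cycs π A := image_subset_image hBA hC.2
    rw [hK, mem_insert, mem_insert] at hCK
    rcases hCK with rfl | rfl | h
    · exact absurd rfl hC.1
    · exact absurd ((cyc_mem_cycs_iff hBπ).mp hC.2) hbB
    · exact h
  · intro S hS
    rw [mem_powerset] at hS
    simp only [mem_filter, mem_powerset]
    refine ⟨?_, ⟨?_, ?_⟩, apply_mem_biUnion (hJK S hS)⟩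
    · rw [← biUnion_cycs hπA]
      exact biUnion_subset_biUnion_of_subset_left _ (hJK S hS)
    · exact mem_biUnion.mpr ⟨_, mem_insert_self _ _, self_mem_cyc π a⟩
    · intro h
      obtain ⟨C, hC, hbC⟩ := mem_biUnion.mp h
      rw [← eq_cyc_of_mem_cycs (hJK S hS hC) hbC, mem_insert] at hC
      exact hC.elim (fun e => hne e.symm) fun h => h2 (hS h)
  · intro B hB
    simp only [mem_filter, mem_powerset] at hB ⊢
    rw [insert_erase (cyc_mem_cycs hB.2.1.1), biUnion_cycs hB.2.2]
  · intro S hS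
    rw [mem_powerset] at hS
    simp only [cycs_biUnion (hJK S hS)]
    exact erase_insert fun h => h1 (hS h)
  · intro B hB
    simp only [mem_filter, mem_powerset] at hB
    obtain ⟨hBA, ⟨haB, hbB⟩, hBπ⟩ := hB
    have haK : cyc π a ∈ cycs π B := cyc_mem_cycs haB
    have hbK : cyc π b ∉ cycs π B := fun h => hbB ((cyc_mem_cycs_iff hBπ).mp h)
    set S := (cycs π B).erase (cyc π a) with hS
    have hcS := card_erase_add_one haK
    have hsdiff : cycs π (A \ B) = insert (cyc π b) (J \ S) := by
      rw [cycs_sdiff hBπ, hK]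
      ext C
      simp only [mem_sdiff, mem_insert, hS, mem_erase]
      constructor
      · rintro ⟨rfl | rfl | h, h'⟩
        · exact absurd haK h'
        · exact .inl rfl
        · exact .inr ⟨h, fun h'' => h' h''.2⟩
      · rintro (rfl | ⟨h, h'⟩)
        · exact ⟨.inr (.inl rfl), hbK⟩
        · exact ⟨.inr (.inr h), fun h'' => h' ⟨fun e => h1 (e ▸ h), h''⟩⟩
    have hbJS : cyc π b ∉ J \ S := fun h => h2 (mem_sdiff.mp h).1
    have hBcard : (#B : ℝ) = j + ∑ C ∈ S, (#C : ℝ) := by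
      rw [← sum_card_cycs hBπ, ← add_sum_erase _ _ haK, hc1]
      push_cast
      rfl
    have hABcard : (#(A \ B) : ℝ) = ((#(cyc ρ a) - j : ℕ) : ℝ) + ∑ C ∈ J \ S, (#C : ℝ) := by
      rw [← sum_card_cycs (apply_mem_sdiff hπA hBπ), hsdiff, sum_insert hbJS, hc2]
      push_cast
      rfl
    have hsub : cycs π B ⊆ cycs π A := image_subset_image hBA
    rw [mul_assoc _ _ (∏ C ∈ J, _), ← hprod, factorizationWeight, factorizationWeight, hBcard,
      hABcard, ← prod_sdiff hsub, ← cycs_sdiff hBπ]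
    rw [show ((#(cycs π B) : ℕ) : ℤ) - 3 = #S - 2 by rw [← hcS]; push_cast; ring,
      show ((#(cycs π (A \ B)) : ℕ) : ℤ) - 3 = #(J \ S) - 2 by
        rw [hsdiff, card_insert_of_notMem hbJS]; push_cast; ring]
    ring

theorem sum_factorizationWeight_swap_mul {A : Finset X} (hne : A.Nonempty)
    (hA : ∀ x ∈ A, ρ x ∈ A) (g : X × X → ℝ)
    (hjoin : ∀ a ∈ A, ∀ b ∈ A, cyc ρ a ≠ cyc ρ b →
      g (a, b) = factorizationWeight A (Equiv.swap a b * ρ))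
    (hcut : ∀ a ∈ A, ∀ b ∈ A, a ≠ b → cyc ρ a = cyc ρ b → g (a, b) =
      ∑ B ∈ A.powerset with (a ∈ B ∧ b ∉ B) ∧ ∀ x ∈ B, (Equiv.swap a b * ρ) x ∈ B,
        factorizationWeight B (Equiv.swap a b * ρ) *
          factorizationWeight (A \ B) (Equiv.swap a b * ρ)) :
    ∑ p ∈ A.offDiag, g p =
      2 * (#A + #(cycs ρ A) - 2) * factorizationWeight A ρ := by
  have hcard : ∑ C ∈ cycs ρ A, (#C : ℝ) = #A := by exact_mod_cast sum_card_cycs hA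
  have hkey := cut_join_identity (fun C : Finset X => #C) (cycs ρ A)
    (fun C hC => (nonempty_of_mem_cycs hC).card_pos) (hne.image _) hcard
  rw [factorizationWeight, ← mul_assoc, ← hkey, ← sum_add_distrib]
  simp only [mul_assoc (#_ : ℝ) (#_ : ℝ), ← mul_sum, ← mul_add]
  rw [← sum_comp_cyc hA]
  have hoff : ∑ p ∈ A.offDiag, g p = ∑ a ∈ A, ∑ b ∈ A.erase a, g (a, b) := by
    rw [sum_sigma']
    refine sum_bij' (fun p _ => ⟨p.1, p.2⟩) (fun p _ => (p.1, p.2)) ?_ ?_ ?_ ?_ ?_ <;>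
      simp +contextual [mem_offDiag, eq_comm]
  rw [hoff]
  refine sum_congr rfl fun a ha => ?_
  have hsub : cyc ρ a ⊆ A := cyc_subset hA ha
  have hsplit : A.erase a = (A \ cyc ρ a) ∪ (cyc ρ a).erase a := by
    ext x
    have h1 := @hsub x
    have h2 := self_mem_cyc ρ a
    by_cases hx : x = a
    · subst hx; simp [h2]
    · simp only [mem_erase, mem_union, mem_sdiff]; tauto
  rw [hsplit, sum_union (disjoint_left.mpr fun x hx hx' =>
    (mem_sdiff.mp hx).2 (mem_of_mem_erase hx'))]
  congr 1
  · have herase : (cycs ρ A).erase (cyc ρ a) = cycs ρ (A \ cyc ρ a) := by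
      rw [cycs_sdiff (apply_mem_cyc ρ a), cycs_cyc, sdiff_singleton_eq_erase]
    conv_rhs => rw [herase]
    rw [← sum_comp_cyc (apply_mem_sdiff hA (apply_mem_cyc ρ a))]
    refine sum_congr rfl fun b hb => ?_
    rw [mem_sdiff] at hb
    have hab : cyc ρ a ≠ cyc ρ b := fun e => hb.2 (e ▸ self_mem_cyc ρ b)
    rw [hjoin a ha b hb.1 hab, factorizationWeight_swap_mul_join ha hb.1 hab, ← herase]
  · rw [sum_cyc_erase]
    refine sum_congr rfl fun j hj => ?_
    rw [mem_Ico] at hj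
    have hmem := pow_apply_mem_cyc ρ j a
    rw [hcut a ha _ (hsub hmem) ((card_cyc_spec ρ a).2.2 j hj.1 hj.2).symm (cyc_eq_of_mem hmem).symm,
      sum_factorizationWeight_cut hA ha hj.1 hj.2 rfl]

theorem sum_antidiagonal_numFactorizations {r : ℕ}
    (ih : ∀ i ≤ r, ∀ (A : Finset X) (ρ : Equiv.Perm X), A.Nonempty →
      (∀ x ∈ A, ρ x ∈ A) → i + 2 ≤ #A + #(cycs ρ A) →
      numFactorizations A ρ i = if i + 2 = #A + #(cycs ρ A) then
        2 ^ i * (i.factorial : ℝ) * factorizationWeight A ρ else 0)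
    {A B : Finset X} (hA : ∀ x ∈ A, ρ x ∈ A) (hBA : B ⊆ A) (hB : ∀ x ∈ B, ρ x ∈ B)
    (hne : B.Nonempty) (hne' : (A \ B).Nonempty) (hr : r + 4 ≤ #A + #(cycs ρ A)) :
    ∑ ij ∈ antidiagonal r, (r.choose ij.1 : ℝ) *
        (numFactorizations B ρ ij.1 * numFactorizations (A \ B) ρ ij.2) =
      if r + 4 = #A + #(cycs ρ A) then
        2 ^ r * (r.factorial : ℝ) * (factorizationWeight B ρ * factorizationWeight (A \ B) ρ)
      else 0 := by
  have hcard : #(A \ B) + #B = #A := card_sdiff_add_card_eq_card hBA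
  have hcycs : #(cycs ρ (A \ B)) + #(cycs ρ B) = #(cycs ρ A) := by
    rw [cycs_sdiff hB]
    exact card_sdiff_add_card_eq_card (image_subset_image hBA)
  have hB1 := hne.card_pos
  have hB2 : 0 < #(cycs ρ B) := (hne.image _).card_pos
  have hD := apply_mem_sdiff hA hB
  have hzero : ∀ ij ∈ antidiagonal r, ¬(ij.1 + 2 = #B + #(cycs ρ B) ∧
      ij.2 + 2 = #(A \ B) + #(cycs ρ (A \ B))) → (r.choose ij.1 : ℝ) *
        (numFactorizations B ρ ij.1 * numFactorizations (A \ B) ρ ij.2) = 0 := by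
    rintro ⟨i, j⟩ hij hn
    rw [HasAntidiagonal.mem_antidiagonal] at hij
    dsimp only at hij hn ⊢
    rcases lt_or_ge (i + 2) (#B + #(cycs ρ B)) with h | h
    · rw [ih i (by omega) B ρ hne hB h.le, if_neg h.ne, zero_mul, mul_zero]
    · have h' : j + 2 < #(A \ B) + #(cycs ρ (A \ B)) := by omega
      rw [ih j (by omega) _ ρ hne' hD h'.le, if_neg h'.ne, mul_zero, mul_zero]
  split_ifs with he
  · obtain ⟨i, hi⟩ : ∃ i, i + 2 = #B + #(cycs ρ B) := ⟨#B + #(cycs ρ B) - 2, by omega⟩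
    have hD1 := hne'.card_pos
    have hD2 : 0 < #(cycs ρ (A \ B)) := (hne'.image _).card_pos
    obtain ⟨j, rfl⟩ : ∃ j, r = i + j := ⟨r - i, by omega⟩
    have hj : j + 2 = #(A \ B) + #(cycs ρ (A \ B)) := by omega
    have hfac : (i + j).factorial = (i + j).choose i * i.factorial * j.factorial := by
      rw [Nat.choose_symm_add, Nat.add_choose_mul_factorial_mul_factorial]
    rw [sum_eq_single (i, j), ih i (by omega) B ρ hne hB hi.le, if_pos hi,
      ih j (by omega) _ ρ hne' hD hj.le, if_pos hj, hfac]
    · push_cast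
      ring
    · rintro ⟨i', j'⟩ hij hne
      refine hzero _ hij fun h => hne ?_
      rw [Prod.mk.injEq]
      dsimp only at h
      omega
    · intro h
      exact absurd (HasAntidiagonal.mem_antidiagonal.mpr (show i + j = i + j from rfl)) h
  · refine sum_eq_zero fun ij hij => hzero ij hij fun h => he ?_
    rw [HasAntidiagonal.mem_antidiagonal] at hij
    omega

theorem numFactorizations_eq (r : ℕ) : ∀ (A : Finset X) (ρ : Equiv.Perm X), A.Nonempty →
    (∀ x ∈ A, ρ x ∈ A) → r + 2 ≤ #A + #(cycs ρ A) →
    numFactorizations A ρ r = if r + 2 = #A + #(cycs ρ A) then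
      2 ^ r * (r.factorial : ℝ) * factorizationWeight A ρ else 0 := by
  induction r using Nat.strong_induction_on with
  | _ r ih =>
  intro A ρ hne hA hr
  rcases r with _ | r
  · have hc : #(cycs ρ A) ≤ #A := card_image_le
    have hc0 : 0 < #(cycs ρ A) := (hne.image _).card_pos
    rw [numFactorizations_zero A ρ hA]
    by_cases h1 : #A = 1
    · obtain ⟨a, rfl⟩ := card_eq_one.mp h1
      have hcyc : cyc ρ a = {a} := by
        refine (subset_singleton_iff.mp (cyc_subset hA (mem_singleton_self a))).resolve_left ?_
        exact Finset.Nonempty.ne_empty ⟨a, self_mem_cyc ρ a⟩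
      simp [factorizationWeight, cycs, hcyc, selfPow]
    · rw [if_neg h1, if_neg]
      have := hne.card_pos
      omega
  have hinvB : ∀ (B : Finset X) (π : Equiv.Perm X) (i : ℕ), numFactorizations B π i ≠ 0 →
      ∀ x ∈ B, π x ∈ B := fun B π i h => (apply_mem_of_numFactorizations_ne_zero h).2
  have hjoin : ∀ a ∈ A, ∀ b ∈ A, cyc ρ a ≠ cyc ρ b →
      numFactorizations A (Equiv.swap a b * ρ) r +
        ∑ B ∈ A.powerset with a ∈ B ∧ b ∉ B, ∑ ij ∈ antidiagonal r, (r.choose ij.1 : ℝ) *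
          (numFactorizations B (Equiv.swap a b * ρ) ij.1 *
            numFactorizations (A \ B) (Equiv.swap a b * ρ) ij.2) =
      if r + 1 + 2 = #A + #(cycs ρ A) then
        2 ^ r * (r.factorial : ℝ) * factorizationWeight A (Equiv.swap a b * ρ) else 0 := by
    intro a ha b hb hab
    have hcard : #(cycs (Equiv.swap a b * ρ) A) + 1 = #(cycs ρ A) := by
      have hnot : cyc ρ a ∪ cyc ρ b ∉ ((cycs ρ A).erase (cyc ρ a)).erase (cyc ρ b) := by
        intro h
        simp only [mem_erase] at h
        exact h.2.1 (eq_cyc_of_mem_cycs h.2.2 (mem_union_left _ (self_mem_cyc ρ a))).symm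
      have h1 := card_erase_add_one (cyc_mem_cycs (ρ := ρ) ha)
      have h2 := card_erase_add_one
        (mem_erase.mpr ⟨hab.symm, cyc_mem_cycs hb⟩ : cyc ρ b ∈ (cycs ρ A).erase (cyc ρ a))
      rw [cycs_swap_mul_join ha hab, card_insert_of_notMem hnot]
      omega
    rw [sum_eq_zero, add_zero, ih r (by omega) A _ hne (apply_swap_mul_mem hA ha hb) (by omega)]
    · congr 1
      rw [eq_iff_iff]
      omega
    · intro B hB
      rw [mem_filter] at hB
      refine sum_eq_zero fun ij _ => ?_
      by_contra h
      have hBπ := hinvB _ _ _ (left_ne_zero_of_mul (right_ne_zero_of_mul h))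
      have hsub := cyc_subset hBπ hB.2.1
      obtain ⟨h1, -, -⟩ := cyc_swap_mul_join hab
      rw [h1] at hsub
      exact hB.2.2 (hsub (mem_union_right _ (self_mem_cyc ρ b)))
  have hcut : ∀ a ∈ A, ∀ b ∈ A, a ≠ b → cyc ρ a = cyc ρ b →
      numFactorizations A (Equiv.swap a b * ρ) r +
        ∑ B ∈ A.powerset with a ∈ B ∧ b ∉ B, ∑ ij ∈ antidiagonal r, (r.choose ij.1 : ℝ) *
          (numFactorizations B (Equiv.swap a b * ρ) ij.1 *
            numFactorizations (A \ B) (Equiv.swap a b * ρ) ij.2) =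
      if r + 1 + 2 = #A + #(cycs ρ A) then
        2 ^ r * (r.factorial : ℝ) *
          ∑ B ∈ A.powerset with (a ∈ B ∧ b ∉ B) ∧ ∀ x ∈ B, (Equiv.swap a b * ρ) x ∈ B,
            factorizationWeight B (Equiv.swap a b * ρ) *
              factorizationWeight (A \ B) (Equiv.swap a b * ρ) else 0 := by
    intro a ha b hb hab hcyc
    have hπA := apply_swap_mul_mem hA ha hb
    have hcard : #(cycs (Equiv.swap a b * ρ) A) = #(cycs ρ A) + 1 := by
      obtain ⟨g1, g2, -⟩ := card_cyc_spec ρ a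
      have hbmem : b ∈ cyc ρ a := hcyc ▸ self_mem_cyc ρ b
      rw [cyc_eq_image g1 g2, mem_image] at hbmem
      obtain ⟨j, hj, hjb⟩ := hbmem
      have hj0 : 0 < j := by
        rcases Nat.eq_zero_or_pos j with rfl | hj0
        · exact absurd hjb hab
        · exact hj0
      rw [mem_range] at hj
      obtain ⟨-, -, hdisj, hunion⟩ := cyc_swap_mul_cut hj0 hj hjb
      have hnot : ∀ x ∈ cyc ρ a, cyc (Equiv.swap a b * ρ) x ∉ (cycs ρ A).erase (cyc ρ a) := by
        intro x hx h
        rw [mem_erase] at h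
        exact h.1 (by rw [← eq_cyc_of_mem_cycs h.2 (self_mem_cyc _ x), cyc_eq_of_mem hx])
      have hne' : cyc (Equiv.swap a b * ρ) a ≠ cyc (Equiv.swap a b * ρ) b := fun e =>
        disjoint_left.mp hdisj (self_mem_cyc _ a) (e ▸ self_mem_cyc _ a)
      have h2 := hnot b (hcyc ▸ self_mem_cyc ρ b)
      rw [cycs_swap_mul_cut hA ha hj0 hj hjb, card_insert_of_notMem, card_insert_of_notMem h2]
      · have := card_erase_add_one (cyc_mem_cycs (ρ := ρ) ha)
        omega
      · rw [mem_insert, not_or]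
        exact ⟨hne', hnot a (self_mem_cyc ρ a)⟩
    rw [ih r (by omega) A _ hne hπA (by omega), if_neg (by omega), zero_add]
    have hterm : ∀ B ∈ A.powerset.filter fun B => a ∈ B ∧ b ∉ B,
        ∑ ij ∈ antidiagonal r, (r.choose ij.1 : ℝ) *
          (numFactorizations B (Equiv.swap a b * ρ) ij.1 *
            numFactorizations (A \ B) (Equiv.swap a b * ρ) ij.2) =
        if r + 1 + 2 = #A + #(cycs ρ A) then 2 ^ r * (r.factorial : ℝ) *
          if ∀ x ∈ B, (Equiv.swap a b * ρ) x ∈ B then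
            factorizationWeight B (Equiv.swap a b * ρ) *
              factorizationWeight (A \ B) (Equiv.swap a b * ρ) else 0 else 0 := by
      intro B hB
      rw [mem_filter, mem_powerset] at hB
      by_cases hBπ : ∀ x ∈ B, (Equiv.swap a b * ρ) x ∈ B
      · rw [sum_antidiagonal_numFactorizations (fun i hi => ih i (by omega)) hπA hB.1 hBπ
          ⟨a, hB.2.1⟩ ⟨b, mem_sdiff.mpr ⟨hb, hB.2.2⟩⟩ (by omega), if_pos hBπ]
        congr 1
        rw [eq_iff_iff]
        omega
      · rw [if_neg hBπ, mul_zero, ite_self]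
        refine sum_eq_zero fun ij _ => ?_
        by_contra h
        exact hBπ (hinvB _ _ _ (left_ne_zero_of_mul (right_ne_zero_of_mul h)))
    rw [sum_congr rfl hterm]
    split_ifs
    · rw [← mul_sum, ← sum_filter, filter_filter]
    · exact sum_const_zero
  rw [numFactorizations_succ]
  by_cases he : r + 1 + 2 = #A + #(cycs ρ A)
  · simp only [if_pos he] at hjoin hcut ⊢
    have hfac : (2 : ℝ) ^ r * r.factorial ≠ 0 := by positivity
    have key := sum_factorizationWeight_swap_mul hne hA (fun p =>
      (numFactorizations A (Equiv.swap p.1 p.2 * ρ) r +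
        ∑ B ∈ A.powerset with p.1 ∈ B ∧ p.2 ∉ B, ∑ ij ∈ antidiagonal r, (r.choose ij.1 : ℝ) *
          (numFactorizations B (Equiv.swap p.1 p.2 * ρ) ij.1 *
            numFactorizations (A \ B) (Equiv.swap p.1 p.2 * ρ) ij.2)) / (2 ^ r * r.factorial))
      (fun a ha b hb hab => by
        simp only [hjoin a ha b hb hab]
        rw [mul_div_cancel_left₀ _ hfac])
      (fun a ha b hb hab hcyc => by
        simp only [hcut a ha b hb hab hcyc]
        rw [mul_div_cancel_left₀ _ hfac])
    rw [← sum_div, div_eq_iff hfac] at key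
    rw [key]
    have he' : ((#A : ℝ) + #(cycs ρ A)) = r + 1 + 2 := by exact_mod_cast he.symm
    rw [he', Nat.factorial_succ]
    push_cast
    ring
  · rw [if_neg he]
    refine sum_eq_zero fun p hp => ?_
    obtain ⟨ha, hb, hab⟩ := mem_offDiag.mp hp
    by_cases hcyc : cyc ρ p.1 = cyc ρ p.2
    · rw [hcut _ ha _ hb hab hcyc, if_neg he]
    · rw [hjoin _ ha _ hb hcyc, if_neg he]

end Recursion

section Count

variable {X : Type*} [DecidableEq X] [Fintype X]

theorem cycs_one (A : Finset X) : cycs 1 A = A.image fun x => {x} := by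
  have h : cyc (1 : Equiv.Perm X) = fun x => {x} := by
    ext x y
    simp [mem_cyc, eq_comm]
  rw [cycs, h]

theorem numFactorizations_univ_one [Nonempty X] :
    numFactorizations (univ : Finset X) 1 (2 * Fintype.card X - 2) =
      2 ^ (2 * Fintype.card X - 2) * ((2 * Fintype.card X - 2).factorial : ℝ) *
        (Fintype.card X : ℝ) ^ ((Fintype.card X : ℤ) - 3) := by
  have hinj : Function.Injective fun x : X => ({x} : Finset X) := singleton_injective
  have hcard : #(cycs (1 : Equiv.Perm X) univ) = Fintype.card X := by
    rw [cycs_one, card_image_of_injective _ hinj, card_univ]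
  have hpos : 0 < Fintype.card X := Fintype.card_pos
  rw [numFactorizations_eq _ _ _ univ_nonempty (fun x _ => mem_univ _), if_pos,
    factorizationWeight, hcard, cycs_one, prod_image fun x _ y _ h => hinj h]
  · simp [selfPow]
  · rw [hcard, card_univ]; omega
  · rw [hcard, card_univ]; omega

theorem sum_swap (h : Equiv.Perm X → ℝ) :
    ∑ p : X × X, ind (p.1 ≠ p.2) * h (Equiv.swap p.1 p.2) = 2 * ∑ σ, ind σ.IsSwap * h σ := by
  have hfiber : ∀ σ : Equiv.Perm X,
      ∑ p : X × X with Equiv.swap p.1 p.2 = σ, ind (p.1 ≠ p.2) = 2 * ind σ.IsSwap := by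
    intro σ
    by_cases hσ : σ.IsSwap
    · obtain ⟨x, y, hxy, rfl⟩ := hσ
      rw [ind_of_true ⟨x, y, hxy, rfl⟩]
      have hsub : ({(x, y), (y, x)} : Finset (X × X)) ⊆
          univ.filter fun p => Equiv.swap p.1 p.2 = Equiv.swap x y := by
        simp [insert_subset_iff, Equiv.swap_comm]
      rw [← sum_subset hsub, sum_pair (by simp [hxy]), ind_of_true hxy, ind_of_true hxy.symm]
      · norm_num
      · rintro ⟨a, b⟩ hab hn
        refine ind_of_false fun hne => hn ?_
        have he := (mem_filter.mp hab).2
        dsimp only at he hne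
        have ha : Equiv.swap x y a = b := by rw [← he, Equiv.swap_apply_left]
        have hsw := Equiv.swap_apply_def x y a
        simp only [mem_insert, mem_singleton, Prod.mk.injEq]
        grind
    · rw [ind_of_false hσ, mul_zero]
      refine sum_eq_zero fun p hp => ind_of_false fun hne => hσ ?_
      exact ⟨p.1, p.2, hne, (mem_filter.mp hp).2.symm⟩
  rw [← sum_fiberwise (s := univ) (g := fun p : X × X => Equiv.swap p.1 p.2), mul_sum]
  refine sum_congr rfl fun σ _ => ?_
  rw [← mul_assoc, ← hfiber, sum_mul]
  refine sum_congr rfl fun p hp => ?_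
  rw [(mem_filter.mp hp).2]

theorem wordSum_mul {α : Type*} [Fintype α] (r : ℕ) (c : ℝ) (f : List α → ℝ) :
    wordSum r (fun l => c * f l) = c * wordSum r f := (mul_sum _ _ _).symm

theorem wordSum_swap (r : ℕ) (f : List (Equiv.Perm X) → ℝ) :
    wordSum r (fun l : List (X × X) =>
        ind (∀ p ∈ l, p.1 ≠ p.2) * f (l.map fun p => Equiv.swap p.1 p.2)) =
      2 ^ r * wordSum r fun l => ind (∀ σ ∈ l, σ.IsSwap) * f l := by
  induction r generalizing f with
  | zero => simp [wordSum_zero]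
  | succ r ih =>
    rw [wordSum_succ, wordSum_succ]
    simp only [List.forall_mem_cons, ind_and, List.map_cons, mul_assoc, wordSum_mul]
    have ih' := fun σ => ih fun l => f (σ :: l)
    simp only [ih']
    rw [sum_swap fun σ => 2 ^ r * wordSum r fun l => ind (∀ σ ∈ l, σ.IsSwap) * f (σ :: l),
      mul_sum, mul_sum]
    exact sum_congr rfl fun σ _ => by ring

theorem isFactorizationOn_univ_iff [Nonempty X] (l : List (X × X)) :
    IsFactorizationOn univ 1 l ↔ (∀ p ∈ l, p.1 ≠ p.2) ∧
      (l.map fun p => Equiv.swap p.1 p.2).prod = 1 ∧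
        Subgroup.closure {σ | σ ∈ l.map fun p => Equiv.swap p.1 p.2} = ⊤ := by
  have hprod : (∀ x ∈ univ, wordProd l x = (1 : Equiv.Perm X) x) ↔
      (l.map fun p => Equiv.swap p.1 p.2).prod = 1 := by
    rw [Equiv.ext_iff]
    simp [wordProd]
  have hloop : (∀ p ∈ l, p ∈ (univ : Finset X).offDiag) ↔ ∀ p ∈ l, p.1 ≠ p.2 := by
    simp [mem_offDiag]
  rw [IsFactorizationOn, IsConnectedOn, hprod, hloop]
  set G := Subgroup.closure {σ | σ ∈ l.map fun p => Equiv.swap p.1 p.2} with hG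
  have hmem : ∀ p ∈ l, Equiv.swap p.1 p.2 ∈ G := fun p hp =>
    Subgroup.subset_closure (List.mem_map.mpr ⟨p, hp, rfl⟩)
  suffices h : (∀ p ∈ l, p.1 ≠ p.2) →
      ((∀ B ⊆ (univ : Finset X), B.Nonempty → IsSaturated B l → B = univ) ↔ G = ⊤) by
    have := univ_nonempty (α := X)
    tauto
  intro hne
  constructor
  · intro hconn
    have htrans : MulAction.IsPretransitive G X := by
      refine ⟨fun x y => ?_⟩
      classical
      have hB := hconn (univ.filter fun y => ∃ g : G, g • x = y) (subset_univ _)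
        ⟨x, mem_filter.mpr ⟨mem_univ _, 1, one_smul _ _⟩⟩ (by
          intro p hp
          simp only [mem_filter, mem_univ, true_and]
          constructor
          · rintro ⟨g, hg⟩
            exact ⟨⟨_, hmem p hp⟩ * g, by rw [mul_smul, hg]; exact Equiv.swap_apply_left _ _⟩
          · rintro ⟨g, hg⟩
            exact ⟨⟨_, hmem p hp⟩ * g, by rw [mul_smul, hg]; exact Equiv.swap_apply_right _ _⟩)
      have hy := mem_univ y
      rw [← hB] at hy
      exact (mem_filter.mp hy).2
    refine closure_of_isSwap_of_isPretransitive ?_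
    intro σ hσ
    obtain ⟨p, hp, rfl⟩ := List.mem_map.mp hσ
    exact ⟨p.1, p.2, hne p hp, rfl⟩
  · intro htop B _ hBne hB
    obtain ⟨x, hx⟩ := hBne
    have hpres : ∀ σ ∈ G, ∀ z, σ z ∈ B ↔ z ∈ B := by
      intro σ hσ
      induction hσ using Subgroup.closure_induction with
      | mem σ hσ =>
        obtain ⟨p, hp, rfl⟩ := List.mem_map.mp hσ
        intro z
        have := hB p hp
        rw [Equiv.swap_apply_def]
        split_ifs with h1 h2
        · rw [h1, this]
        · rw [h2, this]
        · rfl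
      | one => simp
      | mul σ τ _ _ h1 h2 => intro z; rw [Equiv.Perm.mul_apply, h1, h2]
      | inv σ _ h => intro z; rw [← h, ← Equiv.Perm.mul_apply, mul_inv_cancel, Equiv.Perm.one_apply]
    refine eq_univ_of_forall fun y => ?_
    have := hpres (Equiv.swap x y) (htop ▸ Subgroup.mem_top _) y
    rw [Equiv.swap_apply_right] at this
    exact this.mp hx

theorem natCard_transposition_factorizations [Nonempty X] (r : ℕ) :
    2 ^ r * (Nat.card {γ : Fin r → Equiv.Perm X // (∀ i, (γ i).IsSwap) ∧
        (List.ofFn γ).prod = 1 ∧ Subgroup.closure (Set.range γ) = ⊤} : ℝ) =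
      numFactorizations (univ : Finset X) 1 r := by
  classical
  have hcard : (Nat.card {γ : Fin r → Equiv.Perm X // (∀ i, (γ i).IsSwap) ∧
        (List.ofFn γ).prod = 1 ∧ Subgroup.closure (Set.range γ) = ⊤} : ℝ) =
      wordSum r fun l : List (Equiv.Perm X) => ind (∀ σ ∈ l, σ.IsSwap) *
        ind (l.prod = 1 ∧ Subgroup.closure {σ | σ ∈ l} = ⊤) := by
    rw [Nat.card_eq_fintype_card, Fintype.card_subtype, card_eq_sum_ones, sum_filter,
      Nat.cast_sum, wordSum]
    refine sum_congr rfl fun γ _ => ?_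
    have hrange : {σ | σ ∈ List.ofFn γ} = Set.range γ := by
      ext σ
      simp [List.mem_ofFn]
    rw [← ind_and, hrange, List.forall_mem_ofFn_iff, ind]
    push_cast
    congr
  rw [hcard, ← wordSum_swap, numFactorizations]
  congr 1
  ext l
  rw [← ind_and]
  congr 1
  exact propext (isFactorizationOn_univ_iff l).symm

end Count

end HurwitzCount

/-- **Hurwitz's formula (genus 0).** For every `d ≥ 1`, the number `N` of
`(2d - 2)`-tuples of transpositions in the symmetric group on `d` letters whose
product (in the indicated order) is the identity and which generate the full
symmetric group satisfies `d ^ 3 * N = (2d - 2)! * d ^ d`. -/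
theorem hurwitz_genus_zero_count (d : ℕ) (hd : 1 ≤ d) :
    d ^ 3 * Nat.card {γ : Fin (2 * d - 2) → Equiv.Perm (Fin d) //
        (∀ i, (γ i).IsSwap) ∧ (List.ofFn γ).prod = 1 ∧
        Subgroup.closure (Set.range γ) = ⊤} =
      (2 * d - 2).factorial * d ^ d := by
  have : Nonempty (Fin d) := ⟨⟨0, hd⟩⟩
  have h := numFactorizations_univ_one (X := Fin d)
  rw [Fintype.card_fin, ← natCard_transposition_factorizations, mul_assoc] at h
  have h' := mul_left_cancel₀ (by positivity) h
  have hd0 : (d : ℝ) ≠ 0 := by positivity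
  have hpow : (d : ℝ) ^ 3 * (d : ℝ) ^ ((d : ℤ) - 3) = (d : ℝ) ^ d := by
    rw [← zpow_natCast, ← zpow_natCast, ← zpow_add₀ hd0]
    congr 1
    push_cast
    ring
  have hmain : (d : ℝ) ^ 3 * (Nat.card {γ : Fin (2 * d - 2) → Equiv.Perm (Fin d) //
        (∀ i, (γ i).IsSwap) ∧ (List.ofFn γ).prod = 1 ∧
        Subgroup.closure (Set.range γ) = ⊤} : ℝ) = ((2 * d - 2).factorial : ℝ) * (d : ℝ) ^ d := by
    rw [h', ← hpow]
    ring
  exact_mod_cast hmain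
end

section
/- For all integers n ≥ 2 and 2 ≤ k ≤ n, the number N_k of doubly rooted trees (T, r, t) on the vertex set {1, …, n} whose trunk contains exactly k vertices (i.e. dist_T(r, t) = k − 1) satisfies n · N_k = k · k! · C(n, k) · n^{n−k}; equivalently, for k ≤ n−1, N_k = k · k! · C(n, k) · n^{n−k−1}. -/
open Finset in
/-- The functions `f : V → V` fixing every vertex outside `W` and such that each vertex of `W` is
eventually mapped into `S`. For disjoint `W` and `S` these are the parent functions of the rooted
forests on `W ∪ S` with root set `S`. -/
noncomputable def parentFunctions {V : Type*} [Fintype V] [DecidableEq V] (W S : Finset V) :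
    Finset (V → V) :=
  open Classical in
  univ.filter fun f => (∀ v ∉ W, f v = v) ∧ ∀ v ∈ W, ∃ i, f^[i] v ∈ S

section ParentFunctions

open Finset

variable {V : Type*} [DecidableEq V]

omit [DecidableEq V] in
lemma exists_iterate_mem_of_eq_off {f g : V → V} (S : Finset V) (h : ∀ v ∉ S, f v = g v) {v : V}
    (hv : ∃ i, f^[i] v ∈ S) : ∃ i, g^[i] v ∈ S := by
  obtain ⟨i, hi⟩ := hv
  induction i generalizing v with
  | zero => exact ⟨0, hi⟩
  | succ i ih =>
    by_cases hvS : v ∈ S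
    · exact ⟨0, hvS⟩
    · obtain ⟨j, hj⟩ := ih (v := f v) hi
      exact ⟨j + 1, by rwa [Function.iterate_succ_apply, ← h v hvS]⟩

lemma exists_iterate_mem_children {W S : Finset V} (hd : Disjoint W S) {f : V → V}
    (hf : ∀ v ∉ W, f v = v) {v : V} (hvW : v ∈ W) (hv : ∃ i, f^[i] v ∈ S) :
    ∃ i, f^[i] v ∈ W.filter (f · ∈ S) := by
  obtain ⟨i, hi⟩ := hv
  induction i generalizing v with
  | zero => exact absurd hi (disjoint_left.1 hd hvW)
  | succ i ih =>
    by_cases hfv : f v ∈ S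
    · exact ⟨0, by simp [hvW, hfv]⟩
    · rw [Function.iterate_succ_apply] at hi
      have hfW : f v ∈ W := by
        by_contra h
        rw [Function.iterate_fixed (hf _ h)] at hi
        exact hfv hi
      obtain ⟨j, hj⟩ := ih hfW hi
      exact ⟨j + 1, hj⟩

variable [Fintype V]

lemma mem_parentFunctions {W S : Finset V} {f : V → V} :
    f ∈ parentFunctions W S ↔ (∀ v ∉ W, f v = v) ∧ ∀ v ∈ W, ∃ i, f^[i] v ∈ S := by
  classical
  simp [parentFunctions]

lemma parentFunctions_empty_left (S : Finset V) : parentFunctions ∅ S = {id} := by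
  ext f
  simp [mem_parentFunctions, funext_iff]

lemma parentFunctions_empty_right {W : Finset V} (hW : W.Nonempty) :
    parentFunctions W ∅ = ∅ := by
  obtain ⟨w, hw⟩ := hW
  ext f
  simp only [mem_parentFunctions, notMem_empty, exists_false, iff_false, not_and]
  exact fun _ h => h w hw

lemma card_parentFunctions_filter_children {W S U : Finset V} (hd : Disjoint W S) (hU : U ⊆ W) :
    #{f ∈ parentFunctions W S | W.filter (f · ∈ S) = U} =
      #S ^ #U * #(parentFunctions (W \ U) U) := by
  have hpi : #(Fintype.piFinset fun v => if v ∈ U then S else {v}) = #S ^ #U := by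
    rw [Fintype.card_piFinset, ← prod_const, ← prod_subset (subset_univ U)]
    · exact prod_congr rfl fun v hv => by simp [hv]
    · intro v _ hv
      simp [hv]
  rw [← hpi, ← card_product]
  refine card_nbij' (fun f => (U.piecewise f id, U.piecewise id f))
    (fun p => U.piecewise p.1 p.2) ?_ ?_ ?_ ?_
  · intro f hf
    simp only [mem_coe, mem_filter, mem_parentFunctions] at hf
    obtain ⟨⟨hfix, hreach⟩, rfl⟩ := hf
    simp only [mem_coe, mem_product, Fintype.mem_piFinset, mem_parentFunctions]
    refine ⟨fun v => ?_, fun v hv => ?_, fun v hv => ?_⟩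
    · by_cases hv : v ∈ W.filter (f · ∈ S)
      · simpa [piecewise_eq_of_mem _ _ _ hv, hv] using (mem_filter.1 hv).2
      · simp [hv]
    · by_cases hvU : v ∈ W.filter (f · ∈ S)
      · simp [piecewise_eq_of_mem _ _ _ hvU]
      · rw [piecewise_eq_of_notMem _ _ _ hvU]
        exact hfix v fun h => hv (mem_sdiff.2 ⟨h, hvU⟩)
    · have hvW := (mem_sdiff.1 hv).1
      exact exists_iterate_mem_of_eq_off (W.filter (f · ∈ S))
        (fun x hx => (piecewise_eq_of_notMem _ _ _ hx).symm)
        (exists_iterate_mem_children hd hfix hvW (hreach v hvW))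
  · rintro ⟨h, g⟩ hp
    simp only [mem_coe, mem_product, Fintype.mem_piFinset, mem_parentFunctions] at hp
    obtain ⟨hh, hfix, hreach⟩ := hp
    have hhU : ∀ v ∈ U, h v ∈ S := fun v hv => by simpa [hv] using hh v
    have hgS : ∀ v ∈ W \ U, g v ∉ S := by
      intro v hv hgv
      have hgW : g v ∉ W := fun h => disjoint_left.1 hd h hgv
      obtain ⟨i, hi⟩ := hreach v hv
      rcases i with _ | i
      · exact (mem_sdiff.1 hv).2 hi
      · rw [Function.iterate_succ_apply,
          Function.iterate_fixed (hfix _ fun h => hgW (mem_sdiff.1 h).1)] at hi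
        exact hgW (hU hi)
    simp only [mem_coe, mem_filter, mem_parentFunctions]
    refine ⟨⟨fun v hv => ?_, fun v hv => ?_⟩, ?_⟩
    · rw [piecewise_eq_of_notMem _ _ _ fun h => hv (hU h)]
      exact hfix v fun h => hv (mem_sdiff.1 h).1
    · have : ∃ i, (U.piecewise h g)^[i] v ∈ U := by
        by_cases hvU : v ∈ U
        · exact ⟨0, hvU⟩
        · exact exists_iterate_mem_of_eq_off U
            (fun x hx => (piecewise_eq_of_notMem _ _ _ hx).symm)
            (hreach v (mem_sdiff.2 ⟨hv, hvU⟩))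
      obtain ⟨i, hi⟩ := this
      refine ⟨i + 1, ?_⟩
      rw [Function.iterate_succ_apply', piecewise_eq_of_mem _ _ _ hi]
      exact hhU _ hi
    · ext v
      by_cases hvU : v ∈ U
      · simp [hvU, hU hvU, hhU]
      · simpa [hvU] using fun hvW => hgS v (mem_sdiff.2 ⟨hvW, hvU⟩)
  · intro f _
    ext v
    by_cases hv : v ∈ U <;> simp [hv]
  · rintro ⟨h, g⟩ hp
    simp only [mem_coe, mem_product, Fintype.mem_piFinset, mem_parentFunctions] at hp
    obtain ⟨hh, hfix, -⟩ := hp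
    ext v
    · by_cases hv : v ∈ U
      · simp [hv]
      · simpa [hv, eq_comm] using hh v
    · by_cases hv : v ∈ U
      · simpa [hv, eq_comm] using hfix v
      · simp [hv]

omit [DecidableEq V] [Fintype V] in
lemma sum_card_mul_pow_mul_pow (W : Finset V) (k m : ℕ) :
    ∑ U ∈ W.powerset, k ^ #U * (#U * m ^ (#W - #U)) = #W * k * (k + m) ^ (#W - 1) := by
  rw [sum_powerset_apply_card (fun j => k ^ j * (j * m ^ (#W - j)))]
  rcases h : #W with _ | w
  · simp
  · rw [sum_range_succ', Nat.add_sub_cancel, add_pow, mul_sum]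
    simp only [zero_mul, mul_zero, smul_zero, add_zero]
    refine sum_congr rfl fun j _ => ?_
    have := Nat.add_one_mul_choose_eq w j
    rw [Nat.add_sub_add_right, smul_eq_mul, pow_succ]
    calc _ = ((w + 1).choose (j + 1) * (j + 1)) * (k ^ j * k * m ^ (w - j)) := by ring
      _ = _ := by rw [← this, Nat.cast_id]; ring

/-- Cayley's formula for rooted forests with a prescribed root set. -/
theorem card_parentFunctions {W S : Finset V} (hd : Disjoint W S) :
    (#W + #S) * #(parentFunctions W S) = #S * (#W + #S) ^ #W := by
  induction h : #W using Nat.strong_induction_on generalizing W S with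
  | _ m ih =>
  subst h
  rcases W.eq_empty_or_nonempty with rfl | hW
  · simp [parentFunctions_empty_left]
  have hpos : 0 < #W := hW.card_pos
  have hsum : #(parentFunctions W S) =
      ∑ U ∈ W.powerset, #S ^ #U * #(parentFunctions (W \ U) U) := by
    rw [card_eq_sum_card_fiberwise (f := fun f => W.filter (f · ∈ S)) (t := W.powerset)
      fun f _ => by simp only [mem_coe, mem_powerset, filter_subset]]
    exact sum_congr rfl fun U hU => card_parentFunctions_filter_children hd (mem_powerset.1 hU)
  have hlayer : ∀ U ∈ W.powerset,
      #W * #(parentFunctions (W \ U) U) = #U * #W ^ (#W - #U) := by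
    intro U hU
    rw [mem_powerset] at hU
    rcases U.eq_empty_or_nonempty with rfl | hU0
    · simp [parentFunctions_empty_right hW]
    have hc : #(W \ U) = #W - #U := card_sdiff_of_subset hU
    have hle := card_le_card hU
    have := ih #(W \ U) (by have := hU0.card_pos; omega) (S := U) sdiff_disjoint rfl
    rwa [hc, Nat.sub_add_cancel hle] at this
  have hmul : #W * #(parentFunctions W S) = #W * (#S * (#S + #W) ^ (#W - 1)) := by
    rw [hsum, mul_sum, ← mul_assoc, ← sum_card_mul_pow_mul_pow]
    refine sum_congr rfl fun U hU => ?_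
    rw [mul_left_comm, hlayer U hU]
  rw [Nat.eq_of_mul_eq_mul_left hpos hmul]
  obtain ⟨w, hw⟩ : ∃ w, #W = w + 1 := ⟨#W - 1, by omega⟩
  rw [hw, Nat.add_sub_cancel]
  ring

end ParentFunctions

/-- The function `f` is the parent function of a tree with root `r`. -/
def IsRootedAt {V : Type*} (f : V → V) (r : V) : Prop :=
  f r = r ∧ ∀ v, ∃ i, f^[i] v = r

/-- The number of applications of `f` needed to reach `r` from `v`. -/
noncomputable def parentDepth {V : Type*} (f : V → V) (r v : V) : ℕ :=
  sInf {i | f^[i] v = r}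

/-- The graph joining every vertex to its image under `f`. -/
def parentGraph {V : Type*} (f : V → V) : SimpleGraph V :=
  SimpleGraph.fromRel fun v w => f v = w

namespace IsRootedAt

variable {V : Type*} {f g : V → V} {r v : V}

lemma parentDepth_root (f : V → V) (r : V) : parentDepth f r r = 0 :=
  Nat.sInf_eq_zero.2 (Or.inl rfl)

lemma parentDepth_of_ne (h : IsRootedAt f r) (hv : v ≠ r) :
    parentDepth f r v = parentDepth f r (f v) + 1 := by
  have h1 : f^[parentDepth f r v] v = r := Nat.sInf_mem (h.2 v)
  have h2 : f^[parentDepth f r (f v)] (f v) = r := Nat.sInf_mem (h.2 (f v))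
  apply le_antisymm
  · exact Nat.sInf_le (by simpa using h2)
  · rcases hd : parentDepth f r v with _ | d
    · rw [hd] at h1
      exact absurd h1 hv
    · rw [hd] at h1
      exact Nat.succ_le_succ (Nat.sInf_le h1)

lemma parentDepth_eq_zero (h : IsRootedAt f r) : parentDepth f r v = 0 ↔ v = r := by
  refine ⟨fun hv => ?_, ?_⟩
  · by_contra hne
    have := h.parentDepth_of_ne hne
    omega
  · rintro rfl
    exact parentDepth_root f v

lemma ne_apply (h : IsRootedAt f r) (hv : v ≠ r) : v ≠ f v := by
  intro he
  have := h.parentDepth_of_ne hv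
  rw [← he] at this
  omega

lemma parentGraph_adj_apply (h : IsRootedAt f r) (hv : v ≠ r) : (parentGraph f).Adj v (f v) :=
  (SimpleGraph.fromRel_adj _ _ _).2 ⟨h.ne_apply hv, Or.inl rfl⟩

lemma parentGraph_reachable_root (h : IsRootedAt f r) (v : V) :
    (parentGraph f).Reachable v r := by
  induction hd : parentDepth f r v generalizing v with
  | zero => rw [h.parentDepth_eq_zero.1 hd]
  | succ d ih =>
    have hv : v ≠ r := by
      rintro rfl
      simp [parentDepth_root] at hd
    have := h.parentDepth_of_ne hv
    exact (h.parentGraph_adj_apply hv).reachable.trans (ih _ (by omega))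

lemma parentGraph_connected (h : IsRootedAt f r) : (parentGraph f).Connected :=
  have : Nonempty V := ⟨r⟩
  ⟨fun v w => (h.parentGraph_reachable_root v).trans (h.parentGraph_reachable_root w).symm⟩

lemma parentGraph_isTree [Finite V] (h : IsRootedAt f r) : (parentGraph f).IsTree := by
  rw [SimpleGraph.isTree_iff_connected_and_card]
  refine ⟨h.parentGraph_connected,
    le_antisymm ?_ h.parentGraph_connected.card_vert_le_card_edgeSet_add_one⟩
  have hsub : (parentGraph f).edgeSet ⊆ Set.image (fun v => s(v, f v)) {r}ᶜ := by
    intro e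
    induction e using Sym2.ind with
    | _ v w =>
      intro he
      rw [SimpleGraph.mem_edgeSet] at he
      obtain ⟨hne, rfl | rfl⟩ := (SimpleGraph.fromRel_adj _ _ _).1 he
      · exact ⟨v, fun hv : v = r => hne (by rw [hv, h.1]), rfl⟩
      · exact ⟨w, fun hw : w = r => hne (by rw [hw, h.1]), Sym2.eq_swap⟩
  have h1 := (Set.ncard_le_ncard hsub (Set.toFinite _)).trans
    (Set.ncard_image_le (Set.toFinite _))
  have h2 := Set.ncard_add_ncard_compl {r}
  rw [Set.ncard_singleton] at h2
  rw [Nat.card_coe_set_eq]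
  omega

lemma parentDepth_le_add_length (h : IsRootedAt f r) {v w : V} (p : (parentGraph f).Walk v w) :
    parentDepth f r v ≤ parentDepth f r w + p.length := by
  induction p with
  | nil => simp
  | @cons a b c hab p ih =>
    rw [SimpleGraph.Walk.length_cons]
    obtain ⟨hne, rfl | rfl⟩ := (SimpleGraph.fromRel_adj _ _ _).1 hab
    · have := h.parentDepth_of_ne (v := a) fun ha => hne (by rw [ha, h.1])
      omega
    · have := h.parentDepth_of_ne (v := b) fun hb => hne (by rw [hb, h.1])
      omega

lemma dist_parentGraph (h : IsRootedAt f r) (v : V) :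
    (parentGraph f).dist v r = parentDepth f r v := by
  apply le_antisymm
  · induction hd : parentDepth f r v generalizing v with
    | zero => simp [h.parentDepth_eq_zero.1 hd]
    | succ d ih =>
      have hv : v ≠ r := by
        rintro rfl
        simp [parentDepth_root] at hd
      have h1 := h.parentDepth_of_ne hv
      have h2 := ih (f v) (by omega)
      have h3 := h.parentGraph_connected.dist_triangle (u := v) (v := f v) (w := r)
      rw [SimpleGraph.dist_eq_one_iff_adj.2 (h.parentGraph_adj_apply hv)] at h3
      omega
  · obtain ⟨p, hp⟩ := h.parentGraph_connected.exists_walk_length_eq_dist v r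
    have := h.parentDepth_le_add_length p
    rwa [parentDepth_root, zero_add, hp] at this

lemma eq_of_parentGraph_eq (hf : IsRootedAt f r) (hg : IsRootedAt g r)
    (h : parentGraph f = parentGraph g) : f = g := by
  funext v
  by_cases hv : v = r
  · rw [hv, hf.1, hg.1]
  have hadj : (parentGraph g).Adj v (f v) := h ▸ hf.parentGraph_adj_apply hv
  obtain ⟨-, he | he⟩ := (SimpleGraph.fromRel_adj _ _ _).1 hadj
  · exact he.symm
  · have hdepth : ∀ x, parentDepth f r x = parentDepth g r x := fun x => by
      rw [← hf.dist_parentGraph, ← hg.dist_parentGraph, h]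
    have h1 := hf.parentDepth_of_ne hv
    have hfv : f v ≠ r := fun hfv => hv (by rw [← he, hfv, hg.1])
    have h2 := hg.parentDepth_of_ne hfv
    rw [he, ← hdepth, ← hdepth] at h2
    omega

lemma parentDepth_iterate_add (h : IsRootedAt f r) (t : V) {i : ℕ} (hi : i ≤ parentDepth f r t) :
    parentDepth f r (f^[i] t) + i = parentDepth f r t := by
  induction i with
  | zero => rfl
  | succ i ih =>
    have h1 := ih (by omega)
    have h2 := h.parentDepth_of_ne (v := f^[i] t) fun he => by
      rw [he, parentDepth_root] at h1
      omega
    rw [Function.iterate_succ_apply']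
    omega

end IsRootedAt

lemma SimpleGraph.IsTree.exists_parentGraph_eq {V : Type*} {T : SimpleGraph V} (hT : T.IsTree)
    (r : V) : ∃ f, IsRootedAt f r ∧ parentGraph f = T := by
  have hstep : ∀ v, ∃ w, (v = r → w = r) ∧ (v ≠ r → T.Adj v w ∧ T.dist w r + 1 = T.dist v r) := by
    intro v
    by_cases hv : v = r
    · exact ⟨r, fun _ => rfl, fun h => absurd hv h⟩
    · obtain ⟨p, hp⟩ := hT.connected.exists_walk_length_eq_dist v r
      cases p with
      | nil => exact absurd rfl hv
      | @cons _ w _ hvw p =>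
        refine ⟨w, fun h => absurd h hv, fun _ => ⟨hvw, ?_⟩⟩
        have h1 := T.dist_le p
        have h2 := hT.connected.dist_triangle (u := v) (v := w) (w := r)
        rw [SimpleGraph.dist_eq_one_iff_adj.2 hvw] at h2
        rw [SimpleGraph.Walk.length_cons] at hp
        omega
  choose f hfr hf using hstep
  have hroot : IsRootedAt f r := by
    refine ⟨hfr r rfl, fun v => ?_⟩
    induction hd : T.dist v r generalizing v with
    | zero => exact ⟨0, hT.connected.dist_eq_zero_iff.1 hd⟩
    | succ d ih =>
      have hv : v ≠ r := by
        rintro rfl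
        simp at hd
      obtain ⟨i, hi⟩ := ih (f v) (by have := (hf v hv).2; omega)
      exact ⟨i + 1, hi⟩
  have hle : parentGraph f ≤ T := by
    intro v w hvw
    obtain ⟨hne, rfl | rfl⟩ := (SimpleGraph.fromRel_adj _ _ _).1 hvw
    · exact (hf v fun h => hne (by rw [h, hroot.1])).1
    · exact (hf w fun h => hne (by rw [h, hroot.1])).1.symm
  exact ⟨f, hroot, le_antisymm hle
    ((SimpleGraph.isTree_iff_minimal_connected.1 hT).2 hroot.parentGraph_connected hle)⟩

/-- The function `f` is the parent function of a tree whose path from `u 0` to the root is `u`. -/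
def IsTrunkOf {V : Type*} {K : ℕ} (u : Fin (K + 1) ↪ V) (f : V → V) : Prop :=
  (∀ i : Fin K, f (u i.castSucc) = u i.succ) ∧ IsRootedAt f (u (Fin.last K))

namespace IsTrunkOf

variable {V : Type*} {K : ℕ} {u : Fin (K + 1) ↪ V} {f : V → V}

lemma iterate_apply_zero (h : IsTrunkOf u f) (i : Fin (K + 1)) : f^[i] (u 0) = u i := by
  induction i using Fin.induction with
  | zero => rfl
  | succ i ih =>
    rw [Fin.val_succ, Function.iterate_succ_apply', ← Fin.val_castSucc, ih, h.1]

lemma parentDepth_add (h : IsTrunkOf u f) (i : Fin (K + 1)) :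
    parentDepth f (u (Fin.last K)) (u i) + i = K := by
  induction i using Fin.reverseInduction with
  | last => simp [IsRootedAt.parentDepth_root]
  | cast i ih =>
    rw [h.2.parentDepth_of_ne (u.injective.ne (Fin.castSucc_lt_last i).ne), h.1]
    simp only [Fin.val_succ, Fin.val_castSucc] at ih ⊢
    omega

end IsTrunkOf

lemma exists_iterate_eq_last {V : Type*} {K : ℕ} {u : Fin (K + 1) ↪ V} {f : V → V}
    (h : ∀ i : Fin K, f (u i.castSucc) = u i.succ) (i : Fin (K + 1)) :
    ∃ j, f^[j] (u i) = u (Fin.last K) := by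
  induction i using Fin.reverseInduction with
  | last => exact ⟨0, rfl⟩
  | cast i ih =>
    obtain ⟨j, hj⟩ := ih
    exact ⟨j + 1, by rw [Function.iterate_succ_apply, h, hj]⟩

open Finset in
lemma card_isTrunkOf {V : Type*} [Fintype V] [DecidableEq V] {K : ℕ} (u : Fin (K + 1) ↪ V) :
    Nat.card {f // IsTrunkOf u f} = #(parentFunctions (univ.map u)ᶜ (univ.map u)) := by
  classical
  rw [Nat.card_eq_fintype_card, Fintype.card_subtype]
  set S := univ.map u
  have hu : ∀ i, u i ∈ S := fun i => mem_map_of_mem u (mem_univ i)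
  let c : V → V :=
    Function.extend u (Fin.lastCases (u (Fin.last K)) fun i : Fin K => u i.succ) id
  have hc : ∀ i : Fin K, c (u i.castSucc) = u i.succ := fun i => by
    simp [c, u.injective.extend_apply]
  have hc' : c (u (Fin.last K)) = u (Fin.last K) := by simp [c, u.injective.extend_apply]
  refine card_nbij' (fun f => S.piecewise id f) (fun g => S.piecewise c g) ?_ ?_ ?_ ?_
  · intro f hf
    obtain ⟨-, -, -, hreach⟩ := mem_filter.1 hf
    refine mem_parentFunctions.2 ⟨fun v hv => ?_, fun v _ => ?_⟩
    · simp [show v ∈ S by simpa using hv]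
    · obtain ⟨i, hi⟩ := hreach v
      exact exists_iterate_mem_of_eq_off S
        (fun x hx => (piecewise_eq_of_notMem _ _ _ hx).symm) ⟨i, hi ▸ hu _⟩
  · intro g hg
    obtain ⟨-, hreach⟩ := mem_parentFunctions.1 hg
    have hchain : ∀ i : Fin K, S.piecewise c g (u i.castSucc) = u i.succ := fun i => by
      rw [piecewise_eq_of_mem _ _ _ (hu _), hc]
    refine mem_filter.2 ⟨mem_univ _, hchain, ?_, fun v => ?_⟩
    · simpa [hu] using hc'
    · obtain ⟨i, hi⟩ : ∃ i, (S.piecewise c g)^[i] v ∈ S := by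
        by_cases hv : v ∈ S
        · exact ⟨0, hv⟩
        · exact exists_iterate_mem_of_eq_off S
            (fun x hx => (piecewise_eq_of_notMem _ _ _ hx).symm) (hreach v (mem_compl.2 hv))
      obtain ⟨l, -, hl⟩ := mem_map.1 hi
      obtain ⟨j, hj⟩ := exists_iterate_eq_last hchain l
      exact ⟨j + i, by rw [Function.iterate_add_apply, ← hl, hj]⟩
  · intro f hf
    obtain ⟨-, hchain, hroot, -⟩ := mem_filter.1 hf
    funext v
    by_cases hv : v ∈ S
    · obtain ⟨i, -, rfl⟩ := mem_map.1 hv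
      refine (piecewise_eq_of_mem _ _ _ hv).trans ?_
      cases i using Fin.lastCases with
      | last => rw [hc', hroot]
      | cast i => rw [hc, hchain]
    · simp [hv]
  · intro g hg
    obtain ⟨hfix, -⟩ := mem_parentFunctions.1 hg
    funext v
    by_cases hv : v ∈ S
    · simp [hv, hfix v (by simpa using hv)]
    · simp [hv]

/-- Trees with a root and a top at distance `K` correspond to trunks with a parent function. -/
lemma card_doublyRooted_eq_card_isTrunkOf (V : Type*) [Finite V] {K : ℕ} (hK : K ≠ 0) :
    Nat.card {p : SimpleGraph V × V × V //
        (p.1.Connected ∧ p.1.IsAcyclic) ∧ p.2.1 ≠ p.2.2 ∧ p.1.dist p.2.1 p.2.2 = K} =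
      Nat.card (Σ u : Fin (K + 1) ↪ V, {f // IsTrunkOf u f}) := by
  symm
  have hmem : ∀ x : (Σ u : Fin (K + 1) ↪ V, {f // IsTrunkOf u f}),
      (parentGraph x.2.1).dist (x.1 (Fin.last K)) (x.1 0) = K := by
    rintro ⟨u, f, h⟩
    rw [SimpleGraph.dist_comm, h.2.dist_parentGraph]
    exact h.parentDepth_add 0
  refine Nat.card_eq_of_bijective (fun x => ⟨(parentGraph x.2.1, x.1 (Fin.last K), x.1 0),
    ⟨x.2.2.2.parentGraph_isTree.connected, x.2.2.2.parentGraph_isTree.isAcyclic⟩,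
    fun h => hK ?_, hmem x⟩) ⟨?_, ?_⟩
  · rw [← hmem x, show x.1 (Fin.last K) = x.1 0 from h, SimpleGraph.dist_self]
  · rintro ⟨u, f, hf⟩ ⟨w, g, hg⟩ h
    simp only [Subtype.mk.injEq, Prod.mk.injEq] at h
    obtain ⟨hgraph, hlast, hzero⟩ := h
    obtain rfl := hf.2.eq_of_parentGraph_eq (hlast ▸ hg.2) hgraph
    obtain rfl : u = w := by
      ext i
      rw [← hf.iterate_apply_zero, ← hg.iterate_apply_zero, hzero]
    rfl
  · rintro ⟨⟨T, r, t⟩, ⟨hconn, hacyc⟩, -, hdist⟩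
    obtain ⟨f, hf, rfl⟩ := SimpleGraph.IsTree.exists_parentGraph_eq ⟨hconn, hacyc⟩ r
    have hdepth : parentDepth f r t = K := by
      rw [← hf.dist_parentGraph, SimpleGraph.dist_comm]
      exact hdist
    have hiter : ∀ i : Fin (K + 1), parentDepth f r (f^[i] t) + i = K := fun i =>
      (hf.parentDepth_iterate_add t (by omega)).trans hdepth
    let u : Fin (K + 1) ↪ V := ⟨fun i => f^[i] t, fun i j (hij : f^[i] t = f^[j] t) => by
      have hi := hiter i
      have hj := hiter j
      rw [hij] at hi
      exact Fin.ext (by omega)⟩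
    have hlast : u (Fin.last K) = r := hf.parentDepth_eq_zero.1 (by
      have := hiter (Fin.last K)
      rw [Fin.val_last] at this
      exact Nat.add_eq_right.1 this)
    have htrunk : IsTrunkOf u f :=
      ⟨fun i => (Function.iterate_succ_apply' f i t).symm, hlast.symm ▸ hf⟩
    exact ⟨⟨u, f, htrunk⟩, Subtype.ext (Prod.ext rfl (Prod.ext hlast rfl))⟩

/-- For `n ≥ 2` and `2 ≤ k ≤ n`, the number `N` of doubly rooted trees `(T, r, t)`
on the vertex set `{1, …, n}` (a tree `T`, i.e. a connected acyclic simple graph on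
`Fin n`, with two distinct distinguished vertices `r ≠ t`) whose trunk — the unique
path from `r` to `t` — has exactly `k` vertices (i.e. `dist T r t = k - 1`) satisfies
`n * N = k * k! * C(n, k) * n ^ (n - k)`. -/
theorem count_doubly_rooted_trees_by_trunk_size (n k : ℕ) (hn : 2 ≤ n)
    (hk2 : 2 ≤ k) (hk : k ≤ n) :
    n * Nat.card {p : SimpleGraph (Fin n) × Fin n × Fin n //
        (p.1.Connected ∧ p.1.IsAcyclic) ∧ p.2.1 ≠ p.2.2 ∧
        p.1.dist p.2.1 p.2.2 = k - 1} =
      k * k.factorial * n.choose k * n ^ (n - k) := by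
  classical
  obtain ⟨K, rfl⟩ : ∃ K, k = K + 1 := ⟨k - 1, by omega⟩
  rw [Nat.add_sub_cancel, card_doublyRooted_eq_card_isTrunkOf (Fin n) (by omega),
    Nat.card_sigma, Finset.mul_sum]
  have hfiber : ∀ u : Fin (K + 1) ↪ Fin n,
      n * Nat.card {f // IsTrunkOf u f} = (K + 1) * n ^ (n - (K + 1)) := by
    intro u
    have hS : (Finset.univ.map u).card = K + 1 := by simp
    have := card_parentFunctions (disjoint_compl_left (a := Finset.univ.map u))
    rwa [Finset.card_compl, hS, Fintype.card_fin, Nat.sub_add_cancel hk,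
      ← card_isTrunkOf] at this
  rw [Finset.sum_congr rfl fun u _ => hfiber u, Finset.sum_const, Finset.card_univ,
    Fintype.card_embedding_eq, Fintype.card_fin, Fintype.card_fin,
    Nat.descFactorial_eq_factorial_mul_choose, smul_eq_mul]
  ring
end

section
/- Fix k ≥ 1 and let E = ℝ^k. For each n ∈ ℕ let (Ω_n, P_n) be a probability space and X_n, Y_n : Ω_n → E measurable maps, and let X_∞ : Ω_∞ → E be a measurable map on a probability space (Ω_∞, P_∞). Suppose that for every bounded continuous function f : E → ℝ one has ∫ f(X_n) dP_n → ∫ f(X_∞) dP_∞ and ∫ f(X_n − Y_n) dP_n → f(0) as n → ∞. Then for every bounded continuous f : E → ℝ, ∫ f(Y_n) dP_n → ∫ f(X_∞) dP_∞. (If X_n → X_∞ in distribution and X_n − Y_n → 0 in distribution, then Y_n → X_∞ in distribution.) -/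
open MeasureTheory

/-- If `X n → X∞` in distribution and `X n - Y n → 0` in distribution, then
`Y n → X∞` in distribution.  Here the random variables take values in `ℝ^k`
(modelled as `Fin k → ℝ`), each `X n, Y n` lives on a probability space
`(Ω n, P n)`, `X∞` lives on a probability space `(Ω∞, P∞)`, and convergence in
distribution means convergence of the integrals of every bounded continuous
real-valued test function. -/
theorem tendsto_in_distribution_of_sub_tendsto_zero (k : ℕ) (hk : 1 ≤ k)
    (Ω : ℕ → Type) [∀ n, MeasurableSpace (Ω n)]
    (P : ∀ n, Measure (Ω n)) (hP : ∀ n, IsProbabilityMeasure (P n))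
    (Ωinf : Type) [MeasurableSpace Ωinf]
    (Pinf : Measure Ωinf) (hPinf : IsProbabilityMeasure Pinf)
    (X Y : ∀ n, Ω n → (Fin k → ℝ)) (Xinf : Ωinf → (Fin k → ℝ))
    (hX : ∀ n, Measurable (X n)) (hY : ∀ n, Measurable (Y n))
    (hXinf : Measurable Xinf)
    (h1 : ∀ f : (Fin k → ℝ) → ℝ, Continuous f → (∃ C, ∀ v, |f v| ≤ C) →
      Filter.Tendsto (fun n => ∫ ω, f (X n ω) ∂(P n)) Filter.atTop
        (nhds (∫ ω, f (Xinf ω) ∂Pinf)))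
    (h2 : ∀ f : (Fin k → ℝ) → ℝ, Continuous f → (∃ C, ∀ v, |f v| ≤ C) →
      Filter.Tendsto (fun n => ∫ ω, f (X n ω - Y n ω) ∂(P n)) Filter.atTop
        (nhds (f 0)))
    (f : (Fin k → ℝ) → ℝ) (hf : Continuous f) (hfb : ∃ C, ∀ v, |f v| ≤ C) :
    Filter.Tendsto (fun n => ∫ ω, f (Y n ω) ∂(P n)) Filter.atTop
      (nhds (∫ ω, f (Xinf ω) ∂Pinf)) := by
  -- It suffices to test against bounded Lipschitz functions.
  have key : ∀ F : (Fin k → ℝ) → ℝ, (∃ M : ℝ, ∀ x y, dist (F x) (F y) ≤ M) →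
      (∃ L, LipschitzWith L F) →
      Filter.Tendsto (fun n => ∫ ω, F (Y n ω) ∂(P n)) Filter.atTop
        (nhds (∫ ω, F (Xinf ω) ∂Pinf)) := by
    rintro F ⟨M, hM⟩ ⟨L, hL⟩
    have hFc : Continuous F := hL.continuous
    have hM0 : 0 ≤ M := dist_nonneg.trans (hM 0 0)
    have hFb : ∀ v, |F v| ≤ |F 0| + M := fun v => by
      rw [← sub_le_iff_le_add']
      exact (abs_sub_abs_le_abs_sub (F v) (F 0)).trans (hM v 0)
    let g : (Fin k → ℝ) → ℝ := fun v => min (L * ‖v‖) M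
    have hgc : Continuous g := by fun_prop
    have hg0 : ∀ v, 0 ≤ g v := fun v => le_min (by positivity) hM0
    have hgb : ∀ v, |g v| ≤ M := fun v => by
      rw [abs_of_nonneg (hg0 v)]
      exact min_le_right _ _
    have hg : Filter.Tendsto (fun n => ∫ ω, g (X n ω - Y n ω) ∂(P n)) Filter.atTop (nhds 0) := by
      simpa [g, hM0] using h2 g hgc ⟨M, hgb⟩
    have hdiff : Filter.Tendsto (fun n => ∫ ω, F (Y n ω) ∂(P n) - ∫ ω, F (X n ω) ∂(P n))
        Filter.atTop (nhds 0) := by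
      refine squeeze_zero_norm (fun n => ?_) hg
      have hFY : Integrable (fun ω => F (Y n ω)) (P n) :=
        .of_bound (hFc.measurable.comp (hY n)).aestronglyMeasurable _ (ae_of_all _ fun _ => hFb _)
      have hFX : Integrable (fun ω => F (X n ω)) (P n) :=
        .of_bound (hFc.measurable.comp (hX n)).aestronglyMeasurable _ (ae_of_all _ fun _ => hFb _)
      have hgXY : Integrable (fun ω => g (X n ω - Y n ω)) (P n) :=
        .of_bound (hgc.measurable.comp ((hX n).sub (hY n))).aestronglyMeasurable _
          (ae_of_all _ fun _ => hgb _)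
      rw [← integral_sub hFY hFX]
      refine norm_integral_le_of_norm_le hgXY (ae_of_all _ fun ω => le_min ?_ (hM _ _))
      rw [← dist_eq_norm, ← dist_eq_norm, dist_comm (X n ω)]
      exact hL.dist_le_mul _ _
    simpa using hdiff.add (h1 F hFc ⟨_, hFb⟩)
  let μs : ℕ → ProbabilityMeasure (Fin k → ℝ) := fun n =>
    ⟨(P n).map (Y n), Measure.isProbabilityMeasure_map (hY n).aemeasurable⟩
  let μ : ProbabilityMeasure (Fin k → ℝ) :=
    ⟨Pinf.map Xinf, Measure.isProbabilityMeasure_map hXinf.aemeasurable⟩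
  have integral_μs : ∀ F : (Fin k → ℝ) → ℝ, Continuous F → ∀ n,
      ∫ v, F v ∂(μs n : Measure (Fin k → ℝ)) = ∫ ω, F (Y n ω) ∂(P n) := fun F hF n =>
    integral_map (hY n).aemeasurable hF.aestronglyMeasurable
  have integral_μ : ∀ F : (Fin k → ℝ) → ℝ, Continuous F →
      ∫ v, F v ∂(μ : Measure (Fin k → ℝ)) = ∫ ω, F (Xinf ω) ∂Pinf := fun F hF =>
    integral_map hXinf.aemeasurable hF.aestronglyMeasurable
  have hμ : Filter.Tendsto μs Filter.atTop (nhds μ) := by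
    rw [tendsto_iff_forall_lipschitz_integral_tendsto]
    rintro F hFb ⟨L, hL⟩
    simpa only [integral_μs F hL.continuous, integral_μ F hL.continuous] using key F hFb ⟨L, hL⟩
  obtain ⟨C, hC⟩ := hfb
  have := ProbabilityMeasure.tendsto_iff_forall_integral_tendsto.1 hμ
    (BoundedContinuousFunction.ofNormedAddCommGroup f hf C hC)
  simpa only [BoundedContinuousFunction.coe_ofNormedAddCommGroup, integral_μs f hf,
    integral_μ f hf] using this
end

section
/- The Borel distribution is a probability measure on the positive integers: ∑_{k=1}^∞ (k^{k−1}/k!) · e^{−k} = 1. -/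
/-- Finite differences of order `n` annihilate `x ↦ x ^ j` for `j < n`. -/
theorem sum_neg_one_pow_mul_choose_mul_pow_eq_zero {j n : ℕ} (h : j < n) :
    ∑ k ∈ Finset.range (n + 1), (-1 : ℝ) ^ (n - k) * n.choose k * (k : ℝ) ^ j = 0 := by
  have h1 := congrFun (fwdDiff_iter_pow_eq_zero_of_lt (R := ℝ) h) 0
  rw [fwdDiff_iter_eq_sum_shift] at h1
  simpa [zsmul_eq_mul] using h1

/-- The coefficients `k ^ (k - 1) / k!` of the tree function, with constant term `0`. -/
noncomputable def treeCoeff (k : ℕ) : ℝ := if k = 0 then 0 else (k : ℝ) ^ (k - 1) / k.factorial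

theorem treeCoeff_nonneg (k : ℕ) : 0 ≤ treeCoeff k := by
  unfold treeCoeff; split_ifs <;> positivity

theorem treeCoeff_le_exp (k : ℕ) : treeCoeff k ≤ Real.exp 1 ^ k := by
  unfold treeCoeff
  split_ifs with hk
  · positivity
  · rw [← Real.exp_nat_mul, mul_one]
    refine le_trans ?_ (Real.pow_div_factorial_le_exp (x := (k : ℝ)) (by positivity) k)
    have : (1 : ℝ) ≤ k := by exact_mod_cast Nat.one_le_iff_ne_zero.2 hk
    gcongr
    omega

theorem sum_antidiagonal_treeCoeff_mul (t : ℝ) (n : ℕ) :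
    ∑ p ∈ Finset.HasAntidiagonal.antidiagonal n,
      treeCoeff p.1 * t ^ p.1 * ((-(p.1 * t)) ^ p.2 / p.2.factorial) = if n = 1 then t else 0 := by
  rcases Nat.lt_or_ge n 2 with hn | hn
  · interval_cases n <;> simp [treeCoeff, Finset.Nat.antidiagonal_succ]
  rw [if_neg (by omega), Finset.Nat.sum_antidiagonal_eq_sum_range_succ
    (fun k m => treeCoeff k * t ^ k * ((-(k * t)) ^ m / m.factorial))]
  have key := sum_neg_one_pow_mul_choose_mul_pow_eq_zero (j := n - 1) (n := n) (by omega)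
  rw [← mul_zero (t ^ n / n.factorial), ← key, Finset.mul_sum]
  refine Finset.sum_congr rfl fun k hk => ?_
  obtain ⟨m, rfl⟩ := Nat.exists_eq_add_of_le (Nat.lt_succ_iff.1 (Finset.mem_range.1 hk))
  rcases Nat.eq_zero_or_pos k with rfl | hk0
  · have : m - 1 ≠ 0 := by omega
    simp [treeCoeff, this]
  obtain ⟨k, rfl⟩ := Nat.exists_eq_succ_of_ne_zero hk0.ne'
  rw [Nat.succ_eq_add_one] at *
  have e1 : k + 1 + m - 1 = k + m := by omega
  rw [Nat.cast_choose ℝ (Nat.le_add_right _ _), Nat.add_sub_cancel_left, e1, treeCoeff, if_neg (by omega)]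
  have h3 : (((k + 1 + m).factorial : ℕ) : ℝ) ≠ 0 := by positivity
  rw [Nat.add_sub_cancel, neg_pow, mul_pow]
  field_simp
  ring

theorem hasSum_treeCoeff_mul_pow_of_small {t : ℝ} (ht : |t| * Real.exp |t| * Real.exp 1 < 1) :
    HasSum (fun k => treeCoeff k * (t * Real.exp (-t)) ^ k) t := by
  set f : ℕ × ℕ → ℝ := fun p =>
    treeCoeff p.1 * t ^ p.1 * ((-(p.1 * t)) ^ p.2 / p.2.factorial) with hf
  have hexp (x : ℝ) : HasSum (fun m : ℕ => x ^ m / m.factorial) (Real.exp x) := by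
    rw [Real.exp_eq_exp_ℝ]; exact NormedSpace.expSeries_div_hasSum_exp x
  have hnorm (k : ℕ) : HasSum (fun m => ‖f (k, m)‖)
      (treeCoeff k * |t| ^ k * Real.exp (k * |t|)) := by
    have := (hexp (k * |t|)).mul_left (treeCoeff k * |t| ^ k)
    convert! this using 2
    simp [hf, abs_of_nonneg (treeCoeff_nonneg k)]
  have hsum : Summable f := by
    refine Summable.of_norm ((summable_prod_of_nonneg fun _ => norm_nonneg _).2
      ⟨fun k => (hnorm k).summable, ?_⟩)
    simp_rw [fun k => (hnorm k).tsum_eq]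
    refine Summable.of_nonneg_of_le (fun k => ?_) (fun k => ?_)
      (summable_geometric_of_lt_one (by positivity) ht)
    · have := treeCoeff_nonneg k
      positivity
    · rw [Real.exp_nat_mul, mul_assoc, ← mul_pow, mul_pow _ (Real.exp 1), mul_comm]
      exact mul_le_mul_of_nonneg_left (treeCoeff_le_exp k) (by positivity)
  have h1 : HasSum (fun k => treeCoeff k * (t * Real.exp (-t)) ^ k) (∑' p, f p) := by
    refine hsum.hasSum.prod_fiberwise fun k => ?_
    convert! (hexp (-(k * t))).mul_left (treeCoeff k * t ^ k) using 1
    rw [mul_pow, ← Real.exp_nat_mul, mul_neg, mul_assoc]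
  have h2 : HasSum (fun n => if n = 1 then t else 0) (∑' p, f p) := by
    refine HasSum.sigma (Finset.HasAntidiagonal.sigmaAntidiagonalEquivProd.hasSum_iff.2
      hsum.hasSum) fun n => ?_
    rw [← sum_antidiagonal_treeCoeff_mul t n, ← Finset.sum_coe_sort]
    exact hasSum_fintype _
  rwa [h2.unique (hasSum_ite_eq 1 t)] at h1

theorem treeCoeff_analyticOnNhd_tsum :
    AnalyticOnNhd ℝ (fun x => ∑' k, treeCoeff k * x ^ k)
      (Metric.ball 0 (Real.exp (-1))) := by
  set p := FormalMultilinearSeries.ofScalars ℝ treeCoeff with hp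
  have hr : ENNReal.ofReal (Real.exp (-1)) ≤ p.radius := by
    refine p.le_radius_of_bound 1 fun n => ?_
    rw [FormalMultilinearSeries.ofScalars_norm, Real.norm_of_nonneg (treeCoeff_nonneg n),
      Real.coe_toNNReal _ (Real.exp_pos _).le]
    calc treeCoeff n * Real.exp (-1) ^ n ≤ Real.exp 1 ^ n * Real.exp (-1) ^ n := by
          gcongr; exact treeCoeff_le_exp n
      _ = 1 := by rw [← mul_pow, ← Real.exp_add]; simp
  have hpos : 0 < ENNReal.ofReal (Real.exp (-1)) := ENNReal.ofReal_pos.2 (Real.exp_pos _)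
  have h := ((p.hasFPowerSeriesOnBall (hpos.trans_le hr)).mono hpos hr).analyticOnNhd
  rw [Metric.eball_ofReal] at h
  convert! h using 1
  ext x
  exact (FormalMultilinearSeries.ofScalars_sum_eq treeCoeff x).symm

theorem mul_exp_neg_lt_exp_neg_one {t : ℝ} (ht : t ≠ 1) : t * Real.exp (-t) < Real.exp (-1) := by
  have h := Real.add_one_lt_exp (sub_ne_zero.2 ht)
  have : Real.exp (-1) = Real.exp (t - 1) * Real.exp (-t) := by rw [← Real.exp_add]; ring_nf
  rw [this]
  have := Real.exp_pos (-t)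
  gcongr
  linarith

theorem tsum_treeCoeff_mul_pow {t : ℝ} (h0 : 0 ≤ t) (h1 : t < 1) :
    ∑' k, treeCoeff k * (t * Real.exp (-t)) ^ k = t := by
  have hsmall {s : ℝ} (hs : |s| < 1 / 10) : |s| * Real.exp |s| * Real.exp 1 < 1 := by
    have he : Real.exp |s| ≤ Real.exp 1 := Real.exp_le_exp.2 (by linarith)
    have h3 := Real.exp_one_lt_d9
    have := Real.exp_pos 1
    calc |s| * Real.exp |s| * Real.exp 1 ≤ 1 / 10 * Real.exp 1 * Real.exp 1 := by gcongr
      _ < 1 := by nlinarith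
  have hmaps : Set.MapsTo (fun s : ℝ => s * Real.exp (-s)) (Set.Ioo (-(1 / 10)) 1)
      (Metric.ball 0 (Real.exp (-1))) := by
    intro s hs
    rw [mem_ball_zero_iff, Real.norm_eq_abs, abs_mul, Real.abs_exp]
    rcases le_or_gt 0 s with h | h
    · rw [abs_of_nonneg h]
      exact mul_exp_neg_lt_exp_neg_one hs.2.ne
    · have := hsmall (s := s) (by rw [abs_of_neg h]; linarith [hs.1])
      rw [Real.exp_neg 1, lt_inv_comm₀ (by rw [abs_of_neg h]; have := neg_pos.2 h; positivity)
        (Real.exp_pos _), lt_inv_comm₀ (Real.exp_pos _)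
        (by rw [abs_of_neg h]; have := neg_pos.2 h; positivity), ← one_div,
        lt_div_iff₀ (Real.exp_pos _)]
      rwa [abs_of_neg h] at this ⊢
  have hana : AnalyticOnNhd ℝ
      (fun s : ℝ => ∑' k, treeCoeff k * (s * Real.exp (-s)) ^ k) (Set.Ioo (-(1 / 10)) 1) :=
    treeCoeff_analyticOnNhd_tsum.comp
      (fun s _ => analyticAt_id.mul (analyticAt_rexp.comp analyticAt_id.neg)) hmaps
  refine hana.eqOn_of_preconnected_of_eventuallyEq analyticOnNhd_id isPreconnected_Ioo
    (z₀ := 0) (by norm_num) ?_ ⟨by linarith, h1⟩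
  filter_upwards [Metric.ball_mem_nhds (0 : ℝ) (by norm_num : (0 : ℝ) < 1 / 10)] with s hs
  exact (hasSum_treeCoeff_mul_pow_of_small (hsmall (by simpa using hs))).tsum_eq

theorem summable_treeCoeff_mul_pow {x : ℝ} (h0 : 0 ≤ x) (h1 : x < Real.exp (-1)) :
    Summable fun k => treeCoeff k * x ^ k := by
  have h : Real.exp 1 * x < 1 := by
    calc Real.exp 1 * x < Real.exp 1 * Real.exp (-1) := by gcongr
      _ = 1 := by rw [← Real.exp_add]; simp
  refine Summable.of_nonneg_of_le (fun k => mul_nonneg (treeCoeff_nonneg k) (by positivity))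
    (fun k => ?_) (summable_geometric_of_lt_one (by positivity) h)
  rw [mul_pow]
  gcongr
  exact treeCoeff_le_exp k

open Filter Topology in
theorem hasSum_treeCoeff_mul_exp_neg_one_pow :
    HasSum (fun k => treeCoeff k * Real.exp (-1) ^ k) 1 := by
  have hnn (k : ℕ) : 0 ≤ treeCoeff k * Real.exp (-1) ^ k :=
    mul_nonneg (treeCoeff_nonneg k) (by positivity)
  have hev : ∀ᶠ t in 𝓝[<] (1 : ℝ), 0 ≤ t ∧ t < 1 := by
    filter_upwards [Ioo_mem_nhdsLT (zero_lt_one' ℝ)] with t ht using ⟨ht.1.le, ht.2⟩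
  have hle (u : Finset ℕ) : ∑ k ∈ u, treeCoeff k * Real.exp (-1) ^ k ≤ 1 := by
    have hc : Continuous fun t : ℝ => ∑ k ∈ u, treeCoeff k * (t * Real.exp (-t)) ^ k := by
      fun_prop
    have hlim := (hc.tendsto 1).mono_left (nhdsWithin_le_nhds (s := Set.Iio 1))
    rw [one_mul] at hlim
    refine le_of_tendsto hlim (hev.mono fun t ht => ?_)
    have hx : 0 ≤ t * Real.exp (-t) := mul_nonneg ht.1 (Real.exp_pos _).le
    refine ((summable_treeCoeff_mul_pow hx (mul_exp_neg_lt_exp_neg_one ht.2.ne)).sum_le_tsum u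
      fun k _ => mul_nonneg (treeCoeff_nonneg k) (by positivity)).trans ?_
    rw [tsum_treeCoeff_mul_pow ht.1 ht.2]
    exact ht.2.le
  have hs := summable_of_sum_le hnn hle
  have hge : 1 ≤ ∑' k, treeCoeff k * Real.exp (-1) ^ k := by
    refine le_of_tendsto (tendsto_id.mono_left (nhdsWithin_le_nhds (s := Set.Iio 1)))
      (hev.mono fun t ht => ?_)
    have hx : 0 ≤ t * Real.exp (-t) := mul_nonneg ht.1 (Real.exp_pos _).le
    have hlt := mul_exp_neg_lt_exp_neg_one ht.2.ne
    rw [id, ← tsum_treeCoeff_mul_pow ht.1 ht.2]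
    refine (summable_treeCoeff_mul_pow hx hlt).tsum_le_tsum (fun k => ?_) hs
    have := treeCoeff_nonneg k
    gcongr
  exact hs.hasSum_iff.2 (le_antisymm (hs.tsum_le_of_sum_le hle) hge)

/-- **The Borel distribution is a probability measure** on the positive integers:
`∑_{k ≥ 1} (k^(k-1) / k!) * e^(-k) = 1` (the term at `k = 0` is set to `0`). -/
theorem borel_distribution_is_probability :
    HasSum (fun k : ℕ => if k = 0 then 0 else
      (k : ℝ) ^ (k - 1) / k.factorial * Real.exp (-(k : ℝ))) 1 := by
  convert! hasSum_treeCoeff_mul_exp_neg_one_pow using 2 with k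
  rw [treeCoeff, ← Real.exp_nat_mul, mul_neg_one]
  split_ifs <;> simp
end
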